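/- Let n ≥ 2, let P ⊆ ℝⁿ be a bounded DH-polytope with 0 ∉ P, and let g : ℝⁿ \ {0} → ℝⁿ be the inversion g(x) = x/‖x‖². Then both limits lim_{ε→0⁺} μ_ε(P) and lim_{ε→0⁺} μ_ε(g(P)) exist and are equal, where g(P) denotes the image of P under g. (Proposition 7.1: μ_u(P) is invariant under inversion, the key step in proving that the volume V_n(P) is invariant under isometries of the double hyperbolic space.) -/

import Mathlib

open MeasureTheory Filter Metric

variable {n : ℕ} [NeZero n]

/-- A *DH-half-space* in `ℝⁿ` (upper half-space model of the double hyperbolic space `DHⁿ`):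
either a closed ball whose center has first coordinate `0`, or the complement of an open ball
whose center has first coordinate `0`, or a closed affine half-space whose normal vector is
nonzero with first coordinate `0`. -/
def IsDHHalfSpace (H : Set (EuclideanSpace ℝ (Fin n))) : Prop :=
  (∃ (c : EuclideanSpace ℝ (Fin n)) (r : ℝ), 0 < r ∧ c 0 = 0 ∧ H = closedBall c r) ∨
  (∃ (c : EuclideanSpace ℝ (Fin n)) (r : ℝ), 0 < r ∧ c 0 = 0 ∧ H = (ball c r)ᶜ) ∨
  (∃ (v : EuclideanSpace ℝ (Fin n)) (t : ℝ), v ≠ 0 ∧ v 0 = 0 ∧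
    H = {x | t ≤ inner v x (𝕜 := ℝ)})

/-- A *DH-polytope* in `ℝⁿ`: a finite intersection of DH-half-spaces. -/
def IsDHPolytope (P : Set (EuclideanSpace ℝ (Fin n))) : Prop :=
  ∃ S : Finset (Set (EuclideanSpace ℝ (Fin n))), (∀ H ∈ S, IsDHHalfSpace H) ∧ P = ⋂₀ ↑S

/-- `μ_ε(P) = ∫_P (x₀ - εi)^{-n} dx`. -/
noncomputable def dhInt (n : ℕ) [NeZero n] (P : Set (EuclideanSpace ℝ (Fin n))) (ε : ℝ) : ℂ :=
  ∫ x in P, ((x 0 : ℂ) - (ε : ℂ) * Complex.I) ^ (-(n : ℤ))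

open scoped ContDiff

/-- The strict comparison `a < b` if `s` holds and the weak comparison `a ≤ b` otherwise. -/
def CmpRel (s : Bool) (a b : ℝ) : Prop := if s then a < b else a ≤ b

lemma cmpRel_true {a b : ℝ} : CmpRel true a b ↔ a < b := by simp [CmpRel]

lemma cmpRel_false {a b : ℝ} : CmpRel false a b ↔ a ≤ b := by simp [CmpRel]

lemma CmpRel.le {s : Bool} {a b : ℝ} (h : CmpRel s a b) : a ≤ b := by
  cases s
  · exact cmpRel_false.1 h
  · exact (cmpRel_true.1 h).le

lemma not_cmpRel {s : Bool} {a b : ℝ} : ¬ CmpRel s a b ↔ CmpRel (!s) b a := by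
  cases s <;> simp [CmpRel]

/-- Finite intersections of sets defined by one comparison of two functions of a family `L`. -/
inductive PolyGen {X : Type*} (L : Set (X → ℝ)) : Set X → Prop
  | univ : PolyGen L Set.univ
  | inter {C : Set X} {ℓ₁ ℓ₂ : X → ℝ} (s : Bool) : PolyGen L C → ℓ₁ ∈ L → ℓ₂ ∈ L →
      PolyGen L (C ∩ {x | CmpRel s (ℓ₁ x) (ℓ₂ x)})

lemma PolyGen.preimage {X Y : Type*} {L : Set (X → ℝ)} {M : Set (Y → ℝ)} (φ : Y → X)
    (hφ : ∀ ℓ ∈ L, ℓ ∘ φ ∈ M) {C : Set X} (hC : PolyGen L C) : PolyGen M (φ ⁻¹' C) := by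
  induction hC with
  | univ => exact PolyGen.univ
  | inter s _ h₁ h₂ ih => exact PolyGen.inter s ih (hφ _ h₁) (hφ _ h₂)

lemma measurableSet_cmpRel {X : Type*} [MeasurableSpace X] {f g : X → ℝ} (s : Bool)
    (hf : Measurable f) (hg : Measurable g) : MeasurableSet {x | CmpRel s (f x) (g x)} := by
  cases s
  · simpa only [cmpRel_false] using measurableSet_le hf hg
  · simpa only [cmpRel_true] using measurableSet_lt hf hg

lemma PolyGen.measurableSet {X : Type*} [MeasurableSpace X] {L : Set (X → ℝ)}
    (hL : ∀ ℓ ∈ L, Measurable ℓ) {C : Set X} (hC : PolyGen L C) : MeasurableSet C := by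
  induction hC with
  | univ => exact MeasurableSet.univ
  | inter s _ h₁ h₂ ih => exact ih.inter (measurableSet_cmpRel s (hL _ h₁) (hL _ h₂))

/-- A family of sets closed under disjoint unions and under proper differences. -/
structure IsDiffClosed {X : Type*} (good : Set X → Prop) : Prop where
  union : ∀ {A B}, good A → good B → Disjoint A B → good (A ∪ B)
  diff : ∀ {A B}, good A → good B → B ⊆ A → good (A \ B)

namespace IsDiffClosed

variable {X : Type*} {good : Set X → Prop} {L : Set (X → ℝ)} {θ : X → ℝ}

/-- On a set where a family of functions is compared, the constraint `θ ≤ min ℓ₀ ℓ₁` can be split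
according to which of `ℓ₀`, `ℓ₁` is the smaller one. -/
lemma split (h : IsDiffClosed good) {S : Set X}
    (hS : ∀ C, PolyGen L C → ∀ ℓ ∈ L, ∀ s, good (S ∩ C ∩ {x | CmpRel s (θ x) (ℓ x)}))
    {C : Set X} (hC : PolyGen L C) {ℓ₀ ℓ₁ : X → ℝ} (h₀ : ℓ₀ ∈ L) (h₁ : ℓ₁ ∈ L) (s₀ s₁ : Bool) :
    good (S ∩ C ∩ {x | CmpRel s₀ (θ x) (ℓ₀ x)} ∩ {x | CmpRel s₁ (θ x) (ℓ₁ x)}) := by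
  have key := h.union (hS _ (hC.inter (!s₀) h₀ h₁) ℓ₀ h₀ s₀)
    (hS _ (hC.inter s₀ h₁ h₀) ℓ₁ h₁ s₁) ?_
  · convert key using 1
    ext x
    simp only [Set.mem_inter_iff, Set.mem_ofPred_eq, Set.mem_union]
    cases s₀ <;> cases s₁ <;> simp only [cmpRel_true, cmpRel_false, Bool.not_true, Bool.not_false]
      <;> grind
  · rw [Set.disjoint_left]
    rintro x ⟨⟨_, _, hx⟩, _⟩ ⟨⟨_, _, hx'⟩, _⟩
    exact not_cmpRel.2 (by simpa using hx) hx'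

lemma empty (h : IsDiffClosed good) {A : Set X} (hA : good A) : good ∅ := by
  simpa using h.diff hA hA subset_rfl

lemma inter_le (h : IsDiffClosed good)
    (base : ∀ C, PolyGen L C → ∀ ℓ ∈ L, ∀ s, good (C ∩ {x | CmpRel s (θ x) (ℓ x)}))
    {S : Set X} (hS : PolyGen (insert θ L) S) :
    ∀ C, PolyGen L C → ∀ ℓ ∈ L, ∀ s, good (S ∩ C ∩ {x | CmpRel s (θ x) (ℓ x)}) := by
  induction hS with
  | univ => simpa using base
  | @inter S ℓ₁ ℓ₂ s _ h₁ h₂ ih =>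
    intro C hC ℓ₀ h₀ s₀
    rcases h₁ with rfl | h₁ <;> rcases h₂ with rfl | h₂
    · cases s
      · convert ih C hC ℓ₀ h₀ s₀ using 3
        ext x; simp [CmpRel]
      · convert h.empty (ih C hC ℓ₀ h₀ s₀) using 1
        ext x; simp [CmpRel]
    · convert h.split ih hC h₀ h₂ s₀ s using 1
      ext x; simp only [Set.mem_inter_iff]; tauto
    · have := h.diff (ih C hC ℓ₀ h₀ s₀) (h.split ih hC h₀ h₁ s₀ (!s)) Set.inter_subset_left
      convert this using 1
      ext x
      simp only [Set.mem_inter_iff, Set.mem_sdiff, Set.mem_ofPred_eq, ← not_cmpRel]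
      tauto
    · convert ih _ (hC.inter s h₁ h₂) ℓ₀ h₀ s₀ using 1
      ext x; simp only [Set.mem_inter_iff]; tauto

lemma of_polyGen (h : IsDiffClosed good) (base₀ : ∀ C, PolyGen L C → good C)
    (base : ∀ C, PolyGen L C → ∀ ℓ ∈ L, ∀ s, good (C ∩ {x | CmpRel s (θ x) (ℓ x)}))
    {S : Set X} (hS : PolyGen (insert θ L) S) : ∀ C, PolyGen L C → good (S ∩ C) := by
  induction hS with
  | univ => simpa using base₀
  | @inter S ℓ₁ ℓ₂ s hS h₁ h₂ ih =>
    intro C hC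
    have key := h.inter_le base hS
    rcases h₁ with rfl | h₁ <;> rcases h₂ with rfl | h₂
    · cases s
      · convert ih C hC using 2
        ext x; simp [CmpRel]
      · convert h.empty (ih C hC) using 1
        ext x; simp [CmpRel]
    · convert key C hC _ h₂ s using 1
      ext x; simp only [Set.mem_inter_iff]; tauto
    · have := h.diff (ih C hC) (key C hC _ h₁ (!s)) Set.inter_subset_left
      convert this using 1
      ext x
      simp only [Set.mem_inter_iff, Set.mem_sdiff, Set.mem_ofPred_eq, ← not_cmpRel]
      tauto
    · convert ih _ (hC.inter s h₁ h₂) using 1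
      ext x; simp only [Set.mem_inter_iff]; tauto

end IsDiffClosed

open scoped ContDiff Convolution in
/-- Integrals over a fixed bounded set depend smoothly on parameters. -/
lemma contDiffOn_setIntegral_param {E G : Type*} [NormedAddCommGroup E] [NormedSpace ℝ E]
    [NormedAddCommGroup G] [NormedSpace ℝ G] [FiniteDimensional ℝ G] [MeasurableSpace G]
    [BorelSpace G] (μ : Measure G) [IsLocallyFiniteMeasure μ] {U : Set E} (hU : IsOpen U)
    {S : Set G} (hS : MeasurableSet S) (hSb : Bornology.IsBounded S) {f : E × G → ℂ}
    (hf : ContDiffOn ℝ ∞ f (U ×ˢ Set.univ)) :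
    ContDiffOn ℝ ∞ (fun p => ∫ x in S, f (p, x) ∂μ) U := by
  obtain ⟨R, hR⟩ := hSb.subset_closedBall 0
  let χ : ContDiffBump (0 : G) := ⟨max R 1, max R 1 + 1, by positivity, by linarith⟩
  have hχ1 : ∀ x ∈ S, χ x = 1 := fun x hx => χ.one_of_mem_closedBall
    (closedBall_subset_closedBall (le_max_left _ _) (hR hx))
  have key := contDiffOn_convolution_right_with_param_comp (𝕜 := ℝ) (n := ⊤) (μ := μ)
    (ContinuousLinearMap.mul ℝ ℂ) (s := U) (v := fun _ : E => (0 : G)) contDiffOn_const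
    (f := S.indicator (fun _ => (1 : ℂ))) (g := fun p x => (χ (-x) : ℂ) * f (p, -x))
    (k := closedBall 0 (max R 1 + 1)) hU (isCompact_closedBall _ _) ?_ ?_ ?_
  · refine key.congr fun p hp => ?_
    simp only [convolution, zero_sub, neg_neg, ContinuousLinearMap.mul_apply']
    rw [← integral_indicator hS]
    refine integral_congr_ae (Eventually.of_forall fun x => ?_)
    by_cases hx : x ∈ S <;> simp [hx, hχ1]
  · intro p x _ hx
    have : χ (-x) = 0 := χ.zero_of_le_dist (by
      simp only [mem_closedBall, dist_zero_right, not_le] at hx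
      simpa using hx.le)
    simp [this]
  · exact (locallyIntegrable_const (1 : ℂ)).indicator hS
  · have h1 : ContDiff ℝ ∞ (fun q : E × G => ((χ (-q.2) : ℝ) : ℂ)) :=
      Complex.ofRealCLM.contDiff.comp (χ.contDiff.comp contDiff_snd.neg)
    refine h1.contDiffOn.mul (hf.comp (t := U ×ˢ Set.univ) (g := f)
      (f := fun q : E × G => (q.1, -q.2)) ?_ ?_)
    · exact (contDiff_fst.prodMk contDiff_snd.neg).contDiffOn
    · intro q hq; exact ⟨hq.1, trivial⟩

/-- The point of `ℝ^(d+1)` with first coordinate `h` and remaining coordinates `z`. -/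
noncomputable def consE {d : ℕ} (h : ℝ) (z : EuclideanSpace ℝ (Fin d)) :
    EuclideanSpace ℝ (Fin (d + 1)) :=
  WithLp.toLp 2 (Fin.cons h z.ofLp)

/-- The point of `ℝ^d` obtained by dropping the first coordinate. -/
noncomputable def tailE {d : ℕ} (x : EuclideanSpace ℝ (Fin (d + 1))) : EuclideanSpace ℝ (Fin d) :=
  WithLp.toLp 2 (Fin.tail x.ofLp)

section consE

variable {d : ℕ}

@[simp] lemma consE_zero (h : ℝ) (z : EuclideanSpace ℝ (Fin d)) : consE h z 0 = h := rfl

@[simp] lemma consE_succ (h : ℝ) (z : EuclideanSpace ℝ (Fin d)) (i : Fin d) :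
    consE h z i.succ = z i := rfl

@[simp] lemma tailE_apply (x : EuclideanSpace ℝ (Fin (d + 1))) (i : Fin d) :
    tailE x i = x i.succ := rfl

@[simp] lemma consE_tailE (x : EuclideanSpace ℝ (Fin (d + 1))) : consE (x 0) (tailE x) = x := by
  ext i
  refine Fin.cases ?_ (fun i => ?_) i <;> simp

lemma inner_consE (h : ℝ) (z : EuclideanSpace ℝ (Fin d)) (v : EuclideanSpace ℝ (Fin (d + 1))) :
    inner ℝ v (consE h z) = v 0 * h + inner ℝ (tailE v) z := by
  simp [PiLp.inner_apply, Fin.sum_univ_succ, mul_comm]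

lemma norm_sq_consE (h : ℝ) (z : EuclideanSpace ℝ (Fin d)) :
    ‖consE h z‖ ^ 2 = h ^ 2 + ‖z‖ ^ 2 := by
  simp [EuclideanSpace.norm_sq_eq, Fin.sum_univ_succ]

lemma consE_smul (r h : ℝ) (z : EuclideanSpace ℝ (Fin d)) :
    consE (r * h) (r • z) = r • consE h z := by
  ext i
  refine Fin.cases ?_ (fun i => ?_) i <;> simp

lemma contDiff_consE {k : WithTop ℕ∞} :
    ContDiff ℝ k (fun p : ℝ × EuclideanSpace ℝ (Fin d) => consE p.1 p.2) := by
  rw [contDiff_euclidean]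
  intro i
  refine Fin.cases ?_ (fun i => ?_) i
  · simpa using contDiff_fst
  · simp only [consE_succ]
    exact (EuclideanSpace.proj (𝕜 := ℝ) i).contDiff.comp contDiff_snd

lemma injective_consE :
    Function.Injective (fun p : ℝ × EuclideanSpace ℝ (Fin d) => consE p.1 p.2) := by
  rintro ⟨h, z⟩ ⟨h', z'⟩ e
  simp only at e
  have h0 : h = h' := by simpa using congrArg (fun x => x 0) e
  have h1 : z = z' := by
    ext i
    simpa using congrArg (fun x => x i.succ) e
  rw [h0, h1]

lemma measurableEmbedding_consE :
    MeasurableEmbedding (fun p : ℝ × EuclideanSpace ℝ (Fin d) => consE p.1 p.2) :=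
  (contDiff_consE (k := 0)).continuous.measurableEmbedding injective_consE

lemma measurePreserving_consE :
    MeasurePreserving (fun p : ℝ × EuclideanSpace ℝ (Fin d) => consE p.1 p.2) := by
  have h1 : MeasurePreserving (Prod.map (id : ℝ → ℝ) (@WithLp.ofLp 2 (Fin d → ℝ))) :=
    (MeasurePreserving.id volume).prod (PiLp.volume_preserving_ofLp (Fin d))
  have h2 := (volume_preserving_piFinSuccAbove (fun _ : Fin (d + 1) => ℝ) 0).symm
  have h3 := PiLp.volume_preserving_toLp (Fin (d + 1))
  have := h3.comp (h2.comp h1)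
  convert this using 1
  funext p
  simp only [Function.comp, consE, Prod.map, id]
  congr 1
  funext i
  refine Fin.cases ?_ (fun i => ?_) i <;> simp [MeasurableEquiv.piFinSuccAbove, Fin.insertNthEquiv]

lemma integrable_consE {f : EuclideanSpace ℝ (Fin (d + 1)) → ℂ} (hf : Integrable f) :
    Integrable (fun p : ℝ × EuclideanSpace ℝ (Fin d) => f (consE p.1 p.2)) :=
  (measurePreserving_consE.integrable_comp_emb measurableEmbedding_consE).2 hf

lemma integral_consE {f : EuclideanSpace ℝ (Fin (d + 1)) → ℂ} (hf : Integrable f) :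
    ∫ x, f x = ∫ h : ℝ, ∫ z, f (consE h z) := by
  rw [← measurePreserving_consE.integral_comp measurableEmbedding_consE f]
  exact integral_prod _ (integrable_consE hf)

end consE

/-- The linear functions on `ℝ^d`. -/
def linFun (d : ℕ) : Set (EuclideanSpace ℝ (Fin d) → ℝ) := {ℓ | ∃ v, ℓ = fun y => inner ℝ v y}

/-- The affine functions on `ℝ^d`. -/
def affFun (d : ℕ) : Set (EuclideanSpace ℝ (Fin d) → ℝ) :=
  {ℓ | ∃ (a : ℝ) (v : _), ℓ = fun y => a + inner ℝ v y}

/-- Integrals of smooth functions over `{y ∈ K | ‖y‖² ≤ τ}` depend smoothly on parameters and on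
`τ`, on each side of every value of `τ`. -/
def ParamSmooth {d : ℕ} (K : Set (EuclideanSpace ℝ (Fin d))) : Prop :=
  MeasurableSet K ∧ ∀ τ₀ : ℝ, ∃ δ > 0, ∀ (E : Type) [NormedAddCommGroup E] [NormedSpace ℝ E]
    (U : Set E), IsOpen U → ∀ f : E × EuclideanSpace ℝ (Fin d) → ℂ,
    ContDiffOn ℝ ∞ f (U ×ˢ Set.univ) → ∃ F : E × ℝ → ℂ,
      ContDiffOn ℝ ∞ F (U ×ˢ Set.Ioo (τ₀ - δ) (τ₀ + δ)) ∧
      ∀ p ∈ U, ∀ τ ∈ Set.Ioo (τ₀ - δ) τ₀, ∫ y in K ∩ {y | ‖y‖ ^ 2 ≤ τ}, f (p, y) = F (p, τ)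

lemma continuous_section {E G : Type*} [NormedAddCommGroup E] [NormedSpace ℝ E]
    [NormedAddCommGroup G] [NormedSpace ℝ G] {U : Set E} {f : E × G → ℂ}
    (hf : ContDiffOn ℝ ∞ f (U ×ˢ Set.univ)) {p : E} (hp : p ∈ U) :
    Continuous fun y => f (p, y) := by
  rw [← continuousOn_univ]
  exact hf.continuousOn.comp (by fun_prop) fun y _ => ⟨hp, trivial⟩

lemma Continuous.integrableOn_of_isBounded {X : Type*} [MetricSpace X] [ProperSpace X]
    [MeasurableSpace X] [BorelSpace X] {μ : Measure X} [IsLocallyFiniteMeasure μ] {f : X → ℂ}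
    (hf : Continuous f) {S : Set X} (hS : Bornology.IsBounded S) : IntegrableOn f S μ :=
  (hf.continuousOn.integrableOn_compact hS.isCompact_closure).mono_set subset_closure

lemma isBounded_norm_sq_le {G : Type*} [NormedAddCommGroup G] (τ : ℝ) :
    Bornology.IsBounded {y : G | ‖y‖ ^ 2 ≤ τ} := by
  refine (isBounded_iff_forall_norm_le).2 ⟨√τ, fun y hy => Real.le_sqrt_of_sq_le hy⟩

lemma measurableSet_norm_sq_le {G : Type*} [NormedAddCommGroup G] [MeasurableSpace G]
    [BorelSpace G] (τ : ℝ) : MeasurableSet {y : G | ‖y‖ ^ 2 ≤ τ} :=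
  (isClosed_le (by fun_prop) continuous_const).measurableSet

section

variable {d : ℕ}

lemma isDiffClosed_paramSmooth :
    IsDiffClosed (ParamSmooth : Set (EuclideanSpace ℝ (Fin d)) → Prop) where
  union {A B} hA hB hd := by
    refine ⟨hA.1.union hB.1, fun τ₀ => ?_⟩
    obtain ⟨δ₁, h₁, H₁⟩ := hA.2 τ₀
    obtain ⟨δ₂, h₂, H₂⟩ := hB.2 τ₀
    refine ⟨min δ₁ δ₂, lt_min h₁ h₂, fun E _ _ U hU f hf => ?_⟩
    obtain ⟨F₁, hF₁, e₁⟩ := H₁ E U hU f hf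
    obtain ⟨F₂, hF₂, e₂⟩ := H₂ E U hU f hf
    have m₁ := min_le_left δ₁ δ₂
    have m₂ := min_le_right δ₁ δ₂
    refine ⟨fun q => F₁ q + F₂ q, (hF₁.mono ?_).add (hF₂.mono ?_), fun p hp τ hτ => ?_⟩
    · exact Set.prod_mono subset_rfl (Set.Ioo_subset_Ioo (by linarith) (by linarith))
    · exact Set.prod_mono subset_rfl (Set.Ioo_subset_Ioo (by linarith) (by linarith))
    · simp only
      rw [← e₁ p hp τ ⟨by linarith [hτ.1], hτ.2⟩, ← e₂ p hp τ ⟨by linarith [hτ.1], hτ.2⟩,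
        Set.union_inter_distrib_right, setIntegral_union]
      · exact hd.mono Set.inter_subset_left Set.inter_subset_left
      · exact hB.1.inter (measurableSet_norm_sq_le τ)
      · exact (continuous_section hf hp).integrableOn_of_isBounded
          ((isBounded_norm_sq_le τ).subset Set.inter_subset_right)
      · exact (continuous_section hf hp).integrableOn_of_isBounded
          ((isBounded_norm_sq_le τ).subset Set.inter_subset_right)
  diff {A B} hA hB hd := by
    refine ⟨hA.1.diff hB.1, fun τ₀ => ?_⟩
    obtain ⟨δ₁, h₁, H₁⟩ := hA.2 τ₀
    obtain ⟨δ₂, h₂, H₂⟩ := hB.2 τ₀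
    refine ⟨min δ₁ δ₂, lt_min h₁ h₂, fun E _ _ U hU f hf => ?_⟩
    obtain ⟨F₁, hF₁, e₁⟩ := H₁ E U hU f hf
    obtain ⟨F₂, hF₂, e₂⟩ := H₂ E U hU f hf
    have m₁ := min_le_left δ₁ δ₂
    have m₂ := min_le_right δ₁ δ₂
    refine ⟨fun q => F₁ q - F₂ q, (hF₁.mono ?_).sub (hF₂.mono ?_), fun p hp τ hτ => ?_⟩
    · exact Set.prod_mono subset_rfl (Set.Ioo_subset_Ioo (by linarith) (by linarith))
    · exact Set.prod_mono subset_rfl (Set.Ioo_subset_Ioo (by linarith) (by linarith))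
    · simp only
      rw [← e₁ p hp τ ⟨by linarith [hτ.1], hτ.2⟩, ← e₂ p hp τ ⟨by linarith [hτ.1], hτ.2⟩,
        Set.inter_comm, Set.inter_sdiff_distrib_left, setIntegral_sdiff, Set.inter_comm A,
        Set.inter_comm B]
      · exact (measurableSet_norm_sq_le τ).inter hB.1
      · exact (continuous_section hf hp).integrableOn_of_isBounded
          ((isBounded_norm_sq_le τ).subset Set.inter_subset_left)
      · exact Set.inter_subset_inter_right _ hd

lemma ParamSmooth.preimage_isometry {K : Set (EuclideanSpace ℝ (Fin d))} (hK : ParamSmooth K)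
    (e : EuclideanSpace ℝ (Fin d) ≃ₗᵢ[ℝ] EuclideanSpace ℝ (Fin d)) : ParamSmooth (e ⁻¹' K) := by
  refine ⟨hK.1.preimage e.continuous.measurable, fun τ₀ => ?_⟩
  obtain ⟨δ, hδ, H⟩ := hK.2 τ₀
  refine ⟨δ, hδ, fun E _ _ U hU f hf => ?_⟩
  obtain ⟨F, hF, h⟩ := H E U hU (fun q => f (q.1, e.symm q.2)) (hf.comp
    (contDiff_fst.prodMk (e.symm.contDiff.comp contDiff_snd)).contDiffOn
      fun q hq => ⟨hq.1, trivial⟩)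
  refine ⟨F, hF, fun p hp τ hτ => ?_⟩
  rw [← h p hp τ hτ, ← e.measurePreserving.setIntegral_preimage_emb
    e.toHomeomorph.measurableEmbedding (fun y => f (p, e.symm y))]
  simp

lemma paramSmooth_cone {C : Set (EuclideanSpace ℝ (Fin d))} (hm : MeasurableSet C)
    (hC : ∀ r : ℝ, 0 < r → ∀ y, r • y ∈ C ↔ y ∈ C) : ParamSmooth C := by
  refine ⟨hm, fun τ₀ => ?_⟩
  rcases le_or_gt τ₀ 0 with h0 | h0
  · refine ⟨1, one_pos, fun E _ _ U hU f hf => ⟨0, contDiffOn_const, fun p hp τ hτ => ?_⟩⟩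
    have : C ∩ {y | ‖y‖ ^ 2 ≤ τ} = ∅ := by
      ext y
      simp only [Set.mem_inter_iff, Set.mem_ofPred_eq, Set.mem_empty_iff_false, iff_false, not_and,
        not_le]
      intro _
      linarith [sq_nonneg ‖y‖, hτ.2]
    simp [this]
  · refine ⟨τ₀, h0, fun E _ _ U hU f hf => ?_⟩
    have hpar : ContDiffOn ℝ ∞ (fun q : E × ℝ => ∫ y in C ∩ {y | ‖y‖ ^ 2 ≤ 1},
        f (q.1, √q.2 • y)) (U ×ˢ Set.Ioi 0) := by
      refine contDiffOn_setIntegral_param (f := fun q : (E × ℝ) × EuclideanSpace ℝ (Fin d) =>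
        f (q.1.1, √q.1.2 • q.2)) volume (hU.prod isOpen_Ioi)
        (hm.inter (measurableSet_norm_sq_le 1))
        ((isBounded_norm_sq_le 1).subset Set.inter_subset_right) ?_
      refine hf.comp (g := f) (f := fun q : (E × ℝ) × EuclideanSpace ℝ (Fin d) =>
        (q.1.1, √q.1.2 • q.2)) (contDiff_fst.comp contDiff_fst |>.contDiffOn.prodMk
          (ContDiffOn.fun_smul ?_ contDiff_snd.contDiffOn)) fun q hq => ⟨hq.1.1, trivial⟩
      exact ContDiffOn.sqrt (contDiff_snd.comp contDiff_fst).contDiffOn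
        fun q hq => (ne_of_gt hq.1.2)
    have hpow : ContDiffOn ℝ ∞ (fun q : E × ℝ => (√q.2) ^ d) (U ×ˢ Set.Ioi 0) :=
      (contDiff_snd.contDiffOn.sqrt fun q hq => (ne_of_gt hq.2)).pow d
    refine ⟨fun q => (√q.2) ^ d • ∫ y in C ∩ {y | ‖y‖ ^ 2 ≤ 1}, f (q.1, √q.2 • y),
      (hpow.smul hpar).mono (Set.prod_mono subset_rfl fun τ hτ => ?_), fun p hp τ hτ => ?_⟩
    · simpa using hτ.1
    · have hτ0 : 0 < τ := by simpa using hτ.1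
      have hs : 0 < √τ := Real.sqrt_pos.2 hτ0
      simp only
      rw [Measure.setIntegral_comp_smul_of_pos volume (fun y => f (p, y)) _ hs, smul_smul]
      have hfin : Module.finrank ℝ (EuclideanSpace ℝ (Fin d)) = d := by simp
      rw [hfin, mul_inv_cancel₀ (by positivity), one_smul]
      congr 2
      ext y
      rw [Set.mem_smul_set_iff_inv_smul_mem₀ hs.ne']
      simp only [Set.mem_inter_iff, Set.mem_ofPred_eq, hC _ (inv_pos.2 hs), norm_smul, mul_pow,
        norm_inv, inv_pow, Real.norm_eq_abs, sq_abs, Real.sq_sqrt hτ0.le]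
      rw [inv_mul_le_iff₀ hτ0, mul_one]

end

section

variable {d : ℕ}

lemma measurable_of_mem_affFun {ℓ} (h : ℓ ∈ affFun d) : Measurable ℓ := by
  obtain ⟨a, v, rfl⟩ := h
  fun_prop

lemma measurable_of_mem_linFun {ℓ} (h : ℓ ∈ linFun d) : Measurable ℓ := by
  obtain ⟨v, rfl⟩ := h
  fun_prop

lemma PolyGen.smul_mem_iff {C : Set (EuclideanSpace ℝ (Fin d))} (hC : PolyGen (linFun d) C)
    {r : ℝ} (hr : 0 < r) (y : EuclideanSpace ℝ (Fin d)) : r • y ∈ C ↔ y ∈ C := by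
  induction hC with
  | univ => simp
  | inter s _ h₁ h₂ ih =>
    obtain ⟨v₁, rfl⟩ := h₁
    obtain ⟨v₂, rfl⟩ := h₂
    simp only [Set.mem_inter_iff, ih, Set.mem_ofPred_eq, inner_smul_right]
    cases s <;> simp [cmpRel_true, cmpRel_false, hr]

lemma CmpRel.mul_pos_iff {s : Bool} {a b r : ℝ} (hr : 0 < r) :
    CmpRel s (r * a) (r * b) ↔ CmpRel s a b := by
  cases s <;> simp [cmpRel_true, cmpRel_false, hr]

lemma setIntegral_Icc_affine {g : ℝ → ℂ} {b c : ℝ} (h : b ≤ c) :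
    ∫ x in Set.Icc b c, g x = ∫ θ in Set.Icc (0 : ℝ) 1, (c - b) • g (b + θ * (c - b)) := by
  rw [integral_Icc_eq_integral_Ioc, integral_Icc_eq_integral_Ioc,
    ← intervalIntegral.integral_of_le h, ← intervalIntegral.integral_of_le zero_le_one,
    intervalIntegral.integral_smul]
  have := intervalIntegral.smul_integral_comp_add_mul (a := 0) (b := 1) g (c - b) b
  simp only [mul_zero, add_zero, mul_one, add_sub_cancel] at this
  rw [← this]
  simp only [mul_comm]

/-- Polar-type coordinates `y = h • (1, z)` on the half-space `y₀ ≥ b`. -/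
lemma setIntegral_cut_cone {C : Set (EuclideanSpace ℝ (Fin (d + 1)))} (hC : PolyGen (linFun _) C)
    {b τ : ℝ} (hb : 0 < b) (s : Bool) {g : EuclideanSpace ℝ (Fin (d + 1)) → ℂ}
    (hg : Continuous g) :
    ∫ y in C ∩ {y | CmpRel s b (y 0)} ∩ {y | ‖y‖ ^ 2 ≤ τ}, g y =
      ∫ z in {z | consE 1 z ∈ C} ∩ {z | ‖z‖ ^ 2 ≤ τ / b ^ 2 - 1},
        ∫ h in Set.Icc b (√τ / √(1 + ‖z‖ ^ 2)), (h : ℂ) ^ d * g (h • consE 1 z) := by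
  have hCm : MeasurableSet C := hC.measurableSet fun _ => measurable_of_mem_linFun
  set A := C ∩ {y | CmpRel s b (y 0)} ∩ {y | ‖y‖ ^ 2 ≤ τ} with hA
  have hAm : MeasurableSet A := (hCm.inter (measurableSet_cmpRel s measurable_const
    (by fun_prop))).inter (measurableSet_norm_sq_le τ)
  have hAb : Bornology.IsBounded A := (isBounded_norm_sq_le τ).subset Set.inter_subset_right
  have hc1 : Continuous fun p : ℝ × EuclideanSpace ℝ (Fin d) => p.1 • consE 1 p.2 := by
    refine continuous_fst.smul ?_
    exact (contDiff_consE (k := 0)).continuous.comp (continuous_const.prodMk continuous_snd)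
  set B := (fun p : ℝ × EuclideanSpace ℝ (Fin d) => p.1 • consE 1 p.2) ⁻¹' A with hB
  have hBmem : ∀ h z, (h, z) ∈ B ↔ CmpRel s b h ∧ consE 1 z ∈ C ∧
      h ≤ √τ / √(1 + ‖z‖ ^ 2) ∧ ‖z‖ ^ 2 ≤ τ / b ^ 2 - 1 := by
    intro h z
    have hn : ‖h • consE 1 z‖ ^ 2 = h ^ 2 * (1 + ‖z‖ ^ 2) := by
      rw [norm_smul, mul_pow, norm_sq_consE]; simp
    simp only [hB, hA, Set.mem_preimage, Set.mem_inter_iff, Set.mem_ofPred_eq, hn, PiLp.smul_apply,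
      consE_zero, smul_eq_mul, mul_one]
    by_cases hbh : CmpRel s b h
    · have hh := hbh.le
      have hh0 : 0 < h := hb.trans_le hh
      have h1 : 0 < 1 + ‖z‖ ^ 2 := by positivity
      rw [hC.smul_mem_iff hh0]
      have e1 : h ^ 2 * (1 + ‖z‖ ^ 2) ≤ τ ↔ h ≤ √τ / √(1 + ‖z‖ ^ 2) := by
        rw [← Real.sqrt_div' _ h1.le, Real.le_sqrt' hh0, le_div_iff₀ h1]
      have e2 : h ^ 2 * (1 + ‖z‖ ^ 2) ≤ τ → ‖z‖ ^ 2 ≤ τ / b ^ 2 - 1 := by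
        intro h2
        rw [le_sub_iff_add_le, le_div_iff₀ (by positivity)]
        nlinarith [mul_le_mul_of_nonneg_right (pow_le_pow_left₀ hb.le hh 2) h1.le]
      rw [← e1]
      tauto
    · tauto
  have hBm : MeasurableSet B := hAm.preimage hc1.measurable
  have hBb : Bornology.IsBounded B := by
    refine (Bornology.IsBounded.prod (isBounded_Icc b (√τ))
      (isBounded_norm_sq_le (τ / b ^ 2 - 1))).subset ?_
    rintro ⟨h, z⟩ hz
    obtain ⟨h1, -, h3, h4⟩ := (hBmem h z).1 hz
    refine ⟨⟨h1.le, h3.trans (div_le_self (Real.sqrt_nonneg _) ?_)⟩, h4⟩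
    rw [Real.one_le_sqrt]
    nlinarith [sq_nonneg ‖z‖]
  have hψ : Continuous fun p : ℝ × EuclideanSpace ℝ (Fin d) =>
      (p.1 : ℂ) ^ d * g (p.1 • consE 1 p.2) := by
    have := hg.comp hc1
    fun_prop
  have hintg : Integrable (B.indicator fun p : ℝ × EuclideanSpace ℝ (Fin d) =>
      (p.1 : ℂ) ^ d * g (p.1 • consE 1 p.2)) :=
    (hψ.integrableOn_of_isBounded hBb).integrable_indicator hBm
  have step1 : ∀ h, ∫ z, A.indicator g (consE h z) =
      ∫ z, B.indicator (fun p : ℝ × EuclideanSpace ℝ (Fin d) =>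
        (p.1 : ℂ) ^ d * g (p.1 • consE 1 p.2)) (h, z) := by
    intro h
    by_cases hh : 0 < h
    · have := Measure.integral_comp_smul_of_nonneg volume
        (fun z : EuclideanSpace ℝ (Fin d) => A.indicator g (consE h z)) h (hR := hh.le)
      have e : ∀ z : EuclideanSpace ℝ (Fin d), consE h (h • z) = h • consE 1 z := fun z => by
        rw [← consE_smul, mul_one]
      simp only [e, finrank_euclideanSpace, Fintype.card_fin] at this
      rw [eq_inv_smul_iff₀ (by positivity)] at this
      rw [← this, ← integral_smul]
      refine integral_congr_ae (Eventually.of_forall fun z => ?_)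
      by_cases hz : h • consE 1 z ∈ A
      · have hz' : (h, z) ∈ B := hz
        simp [Set.indicator_of_mem hz, Set.indicator_of_mem hz']
      · have hz' : (h, z) ∉ B := hz
        simp [Set.indicator_of_notMem hz, Set.indicator_of_notMem hz']
    · trans (0 : ℂ)
      · refine integral_eq_zero_of_ae (Eventually.of_forall fun z => ?_)
        refine Set.indicator_of_notMem (fun hz => ?_) _
        have : b ≤ h := CmpRel.le hz.1.2
        linarith
      · refine (integral_eq_zero_of_ae (Eventually.of_forall fun z => ?_)).symm
        refine Set.indicator_of_notMem (fun hz => ?_) _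
        have : b ≤ h := ((hBmem h z).1 hz).1.le
        linarith
  have hDm : MeasurableSet ({z : EuclideanSpace ℝ (Fin d) | consE 1 z ∈ C} ∩
      {z | ‖z‖ ^ 2 ≤ τ / b ^ 2 - 1}) := by
    refine MeasurableSet.inter ?_ (measurableSet_norm_sq_le _)
    exact hCm.preimage ((contDiff_consE (k := 0)).continuous.comp
      (continuous_const.prodMk continuous_id)).measurable
  rw [← integral_indicator hAm, ← integral_indicator hDm,
    integral_consE ((hg.integrableOn_of_isBounded hAb).integrable_indicator hAm)]
  simp_rw [step1]
  rw [integral_integral_swap (f := fun h z => B.indicator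
    (fun p : ℝ × EuclideanSpace ℝ (Fin d) => (p.1 : ℂ) ^ d * g (p.1 • consE 1 p.2)) (h, z)) hintg]
  refine integral_congr_ae (Eventually.of_forall fun z => ?_)
  by_cases hz : z ∈ {z | consE 1 z ∈ C} ∩ {z | ‖z‖ ^ 2 ≤ τ / b ^ 2 - 1}
  · have hz1 : consE 1 z ∈ C := hz.1
    have hz2 : ‖z‖ ^ 2 ≤ τ / b ^ 2 - 1 := hz.2
    simp only
    rw [Set.indicator_of_mem hz]
    have e : ∀ h, B.indicator (fun p : ℝ × EuclideanSpace ℝ (Fin d) =>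
        (p.1 : ℂ) ^ d * g (p.1 • consE 1 p.2)) (h, z) =
        {h | CmpRel s b h ∧ h ≤ √τ / √(1 + ‖z‖ ^ 2)}.indicator
          (fun h => (h : ℂ) ^ d * g (h • consE 1 z)) h := by
      intro h
      have : (h, z) ∈ B ↔ h ∈ {h | CmpRel s b h ∧ h ≤ √τ / √(1 + ‖z‖ ^ 2)} := by
        rw [hBmem]; simp only [Set.mem_ofPred_eq]; tauto
      by_cases hh : (h, z) ∈ B
      · rw [Set.indicator_of_mem hh, Set.indicator_of_mem (this.1 hh)]
      · rw [Set.indicator_of_notMem hh, Set.indicator_of_notMem (fun h' => hh (this.2 h'))]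
    simp_rw [e]
    rw [integral_indicator]
    · cases s
      · rfl
      · rw [integral_Icc_eq_integral_Ioc]
        rfl
    · exact (measurableSet_cmpRel s measurable_const measurable_id).inter measurableSet_Iic
  · simp only
    rw [Set.indicator_of_notMem hz]
    refine integral_eq_zero_of_ae (Eventually.of_forall fun h => ?_)
    refine Set.indicator_of_notMem (fun hh => ?_) _
    have := (hBmem h z).1 hh
    exact hz ⟨this.2.1, this.2.2.2⟩

end

section

variable {d : ℕ}

lemma ParamSmooth.of_nonneg {K : Set (EuclideanSpace ℝ (Fin d))} (hm : MeasurableSet K)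
    (h : ∀ τ₀ : ℝ, 0 < τ₀ → ∃ δ > 0, ∀ (E : Type) [NormedAddCommGroup E] [NormedSpace ℝ E]
      (U : Set E), IsOpen U → ∀ f : E × EuclideanSpace ℝ (Fin d) → ℂ,
      ContDiffOn ℝ ∞ f (U ×ˢ Set.univ) → ∃ F : E × ℝ → ℂ,
        ContDiffOn ℝ ∞ F (U ×ˢ Set.Ioo (τ₀ - δ) (τ₀ + δ)) ∧
        ∀ p ∈ U, ∀ τ ∈ Set.Ioo (τ₀ - δ) τ₀,
          ∫ y in K ∩ {y | ‖y‖ ^ 2 ≤ τ}, f (p, y) = F (p, τ)) : ParamSmooth K := by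
  refine ⟨hm, fun τ₀ => ?_⟩
  rcases le_or_gt τ₀ 0 with h0 | h0
  · refine ⟨1, one_pos, fun E _ _ U hU f hf => ⟨0, contDiffOn_const, fun p hp τ hτ => ?_⟩⟩
    have : K ∩ {y | ‖y‖ ^ 2 ≤ τ} = ∅ := by
      ext y
      simp only [Set.mem_inter_iff, Set.mem_ofPred_eq, Set.mem_empty_iff_false, iff_false, not_and,
        not_le]
      intro _
      linarith [sq_nonneg ‖y‖, hτ.2]
    simp [this]
  · exact h τ₀ h0

lemma PolyGen.slice {C : Set (EuclideanSpace ℝ (Fin (d + 1)))} (hC : PolyGen (linFun (d + 1)) C) :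
    PolyGen (affFun d) {z | consE 1 z ∈ C} := by
  refine hC.preimage (consE 1) ?_
  rintro _ ⟨v, rfl⟩
  refine ⟨v 0, tailE v, ?_⟩
  funext z
  simp [inner_consE]

lemma paramSmooth_cut_first (ih : ∀ K, PolyGen (affFun d) K → ParamSmooth K)
    {C : Set (EuclideanSpace ℝ (Fin (d + 1)))} (hC : PolyGen (linFun (d + 1)) C) {b : ℝ}
    (hb : 0 < b) (s : Bool) : ParamSmooth (C ∩ {y | CmpRel s b (y 0)}) := by
  have hCm : MeasurableSet C := hC.measurableSet fun _ => measurable_of_mem_linFun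
  refine ParamSmooth.of_nonneg (hCm.inter (measurableSet_cmpRel s measurable_const
    (by fun_prop))) fun τ₀ h0 => ?_
  obtain ⟨-, H⟩ := ih _ hC.slice
  obtain ⟨δ, hδ, H⟩ := H (τ₀ / b ^ 2 - 1)
  have hb2 : 0 < b ^ 2 := by positivity
  refine ⟨min τ₀ (δ * b ^ 2), lt_min h0 (by positivity), fun E _ _ U hU f hf => ?_⟩
  have m₁ := min_le_left τ₀ (δ * b ^ 2)
  have m₂ := min_le_right τ₀ (δ * b ^ 2)
  let c : (E × ℝ) × EuclideanSpace ℝ (Fin d) → ℝ := fun q => √q.1.2 / √(1 + ‖q.2‖ ^ 2)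
  have hc : ContDiffOn ℝ ∞ c ((U ×ˢ Set.Ioi 0) ×ˢ Set.univ) := by
    refine ContDiffOn.div (ContDiffOn.sqrt (by fun_prop) fun q hq => ne_of_gt hq.1.2)
      (ContDiffOn.sqrt ?_ fun q hq => ?_) fun q hq => ?_
    · exact (contDiff_const.add (contDiff_snd.norm_sq ℝ)).contDiffOn
    · positivity
    · positivity
  let k : ((E × ℝ) × EuclideanSpace ℝ (Fin d)) × ℝ → ℂ := fun q =>
    (c q.1 - b) • (((b + q.2 * (c q.1 - b) : ℝ) : ℂ) ^ d *
      f (q.1.1.1, (b + q.2 * (c q.1 - b)) • consE 1 q.1.2))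
  have hc' : ContDiffOn ℝ ∞ (fun q : ((E × ℝ) × EuclideanSpace ℝ (Fin d)) × ℝ => c q.1)
      (((U ×ˢ Set.Ioi 0) ×ˢ Set.univ) ×ˢ Set.univ) :=
    hc.comp contDiff_fst.contDiffOn fun q hq => hq.1
  have hr : ContDiffOn ℝ ∞ (fun q : ((E × ℝ) × EuclideanSpace ℝ (Fin d)) × ℝ =>
      b + q.2 * (c q.1 - b)) (((U ×ˢ Set.Ioi 0) ×ˢ Set.univ) ×ˢ Set.univ) :=
    contDiffOn_const.add (contDiff_snd.contDiffOn.mul (hc'.sub contDiffOn_const))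
  have hk : ContDiffOn ℝ ∞ k (((U ×ˢ Set.Ioi 0) ×ˢ Set.univ) ×ˢ Set.univ) := by
    refine (hc'.sub contDiffOn_const).smul (ContDiffOn.mul (ContDiffOn.pow ?_ d) ?_)
    · exact Complex.ofRealCLM.contDiff.comp_contDiffOn hr
    · refine hf.comp (g := f) (f := fun q : ((E × ℝ) × EuclideanSpace ℝ (Fin d)) × ℝ =>
        (q.1.1.1, (b + q.2 * (c q.1 - b)) • consE 1 q.1.2)) (ContDiffOn.prodMk (by fun_prop)
          (hr.smul ?_)) fun q hq => ⟨hq.1.1.1, trivial⟩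
      exact (contDiff_consE.comp (contDiff_const.prodMk
        (contDiff_snd.comp contDiff_fst))).contDiffOn
  have hG := contDiffOn_setIntegral_param (volume : Measure ℝ)
    ((hU.prod isOpen_Ioi).prod isOpen_univ) measurableSet_Icc (isBounded_Icc (0 : ℝ) 1) hk
  obtain ⟨F, hF, e⟩ := H (E × ℝ) (U ×ˢ Set.Ioi 0) (hU.prod isOpen_Ioi) _ hG
  refine ⟨fun q => F (q, q.2 / b ^ 2 - 1), ?_, fun p hp τ hτ => ?_⟩
  · refine hF.comp (g := F) (f := fun q : E × ℝ => (q, q.2 / b ^ 2 - 1)) (by fun_prop)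
      fun q hq => ?_
    have h1 := hq.2.1
    have h2 := hq.2.2
    refine ⟨⟨hq.1, ?_⟩, ?_, ?_⟩
    · simp only [Set.mem_Ioi]; linarith
    · simp only
      have : (τ₀ - q.2) / b ^ 2 < δ := by rw [div_lt_iff₀ hb2]; linarith
      rw [sub_div] at this
      linarith
    · simp only
      have : (q.2 - τ₀) / b ^ 2 < δ := by rw [div_lt_iff₀ hb2]; linarith
      rw [sub_div] at this
      linarith
  · have h1 := hτ.1
    have h2 := hτ.2
    have hτ0 : 0 < τ := by linarith
    simp only
    rw [← e (p, τ) ⟨hp, hτ0⟩, setIntegral_cut_cone hC hb s (continuous_section hf hp)]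
    · refine setIntegral_congr_fun ((hC.slice.measurableSet
        fun _ => measurable_of_mem_affFun).inter (measurableSet_norm_sq_le _)) fun z hz => ?_
      have hz2 : ‖z‖ ^ 2 ≤ τ / b ^ 2 - 1 := hz.2
      have hbc : b ≤ √τ / √(1 + ‖z‖ ^ 2) := by
        have h1 : 0 < 1 + ‖z‖ ^ 2 := by positivity
        rw [← Real.sqrt_div' _ h1.le, Real.le_sqrt' hb, le_div_iff₀ h1]
        rw [le_sub_iff_add_le, le_div_iff₀ (by positivity)] at hz2
        linarith
      exact setIntegral_Icc_affine hbc
    · constructor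
      · have : (τ₀ - τ) / b ^ 2 < δ := by rw [div_lt_iff₀ hb2]; linarith
        rw [sub_div] at this
        linarith
      · have : τ / b ^ 2 < τ₀ / b ^ 2 := by gcongr
        linarith

lemma paramSmooth_cut (ih : ∀ K, PolyGen (affFun d) K → ParamSmooth K)
    {C : Set (EuclideanSpace ℝ (Fin (d + 1)))} (hC : PolyGen (linFun (d + 1)) C)
    {v : EuclideanSpace ℝ (Fin (d + 1))} (hv : v ≠ 0) (s : Bool) :
    ParamSmooth (C ∩ {y | CmpRel s 1 (inner ℝ v y)}) := by
  have hv' : 0 < ‖v‖ := norm_pos_iff.2 hv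
  let w : EuclideanSpace ℝ (Fin (d + 1)) := ‖v‖ • EuclideanSpace.single 0 1
  let e := (Submodule.span ℝ {v - w})ᗮ.reflection
  have he : e v = w := Submodule.reflection_sub (by simp [w, norm_smul])
  have hinner : ∀ y, inner ℝ v y = ‖v‖ * (e y) 0 := by
    intro y
    rw [← e.inner_map_map, he]
    simp [w, inner_smul_left, EuclideanSpace.inner_single_left]
  have hC' : PolyGen (linFun (d + 1)) (e.symm ⁻¹' C) := by
    refine hC.preimage _ ?_
    rintro _ ⟨u, rfl⟩
    refine ⟨e u, ?_⟩
    funext y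
    simp only [Function.comp]
    rw [← e.inner_map_map]
    simp
  have := (paramSmooth_cut_first ih hC' (inv_pos.2 hv') s).preimage_isometry e
  convert this using 1
  ext y
  simp only [Set.mem_inter_iff, Set.mem_ofPred_eq, Set.mem_preimage,
    LinearIsometryEquiv.symm_apply_apply, hinner]
  rw [← CmpRel.mul_pos_iff (a := ‖v‖⁻¹) hv', mul_inv_cancel₀ hv'.ne']

lemma paramSmooth_of_polyGen_linFun {C : Set (EuclideanSpace ℝ (Fin d))}
    (hC : PolyGen (linFun d) C) : ParamSmooth C :=
  paramSmooth_cone (hC.measurableSet fun _ => measurable_of_mem_linFun)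
    fun _ hr y => hC.smul_mem_iff hr y

lemma paramSmooth_empty : ParamSmooth (∅ : Set (EuclideanSpace ℝ (Fin d))) :=
  isDiffClosed_paramSmooth.empty (paramSmooth_of_polyGen_linFun PolyGen.univ)

lemma cmpRel_comm_sub {s : Bool} {a b : ℝ} {x y : ℝ} :
    CmpRel s (a + x) (b + y) ↔ CmpRel s (a - b) (y - x) := by
  cases s <;> simp only [cmpRel_true, cmpRel_false] <;> constructor <;> intro h <;> linarith

lemma PolyGen.insert_one_of_affFun {K : Set (EuclideanSpace ℝ (Fin d))}
    (hK : PolyGen (affFun d) K) : PolyGen (insert (fun _ => 1) (linFun d)) K := by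
  induction hK with
  | univ => exact PolyGen.univ
  | @inter C ℓ₁ ℓ₂ s hC h₁ h₂ ih =>
    obtain ⟨a, v, rfl⟩ := h₁
    obtain ⟨b, w, rfl⟩ := h₂
    have key : ∀ y : EuclideanSpace ℝ (Fin d), CmpRel s (a + inner ℝ v y) (b + inner ℝ w y) ↔
        CmpRel s (a - b) (inner ℝ (w - v) y) := fun y => by
      rw [cmpRel_comm_sub, inner_sub_left]
    simp only [key]
    rcases lt_trichotomy (a - b) 0 with hab | hab | hab
    · have : ∀ y : EuclideanSpace ℝ (Fin d), CmpRel s (a - b) (inner ℝ (w - v) y) ↔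
          CmpRel s (inner ℝ ((a - b)⁻¹ • (w - v)) y) 1 := fun y => by
        rw [← CmpRel.mul_pos_iff (b := 1) (r := -(a - b)) (by linarith), inner_smul_left]
        simp only [conj_trivial, ← mul_assoc, neg_mul, mul_inv_cancel₀ hab.ne, one_mul, mul_one]
        cases s <;> simp only [cmpRel_true, cmpRel_false] <;> constructor <;> intro h <;> linarith
      simp only [this]
      exact ih.inter s (Or.inr ⟨_, rfl⟩) (Or.inl rfl)
    · simp only [hab]
      refine ih.inter (ℓ₁ := fun _ => 0) s (Or.inr ⟨0, by simp⟩) (Or.inr ⟨_, rfl⟩)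
    · have : ∀ y : EuclideanSpace ℝ (Fin d), CmpRel s (a - b) (inner ℝ (w - v) y) ↔
          CmpRel s 1 (inner ℝ ((a - b)⁻¹ • (w - v)) y) := fun y => by
        rw [← CmpRel.mul_pos_iff (a := 1) (r := a - b) hab, inner_smul_left]
        simp only [conj_trivial, ← mul_assoc, mul_inv_cancel₀ hab.ne', one_mul, mul_one]
      simp only [this]
      exact ih.inter s (Or.inl rfl) (Or.inr ⟨_, rfl⟩)

theorem paramSmooth_of_polyGen_affFun :
    ∀ (d : ℕ) (K : Set (EuclideanSpace ℝ (Fin d))), PolyGen (affFun d) K → ParamSmooth K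
  | 0, K, hK => by
    refine paramSmooth_cone (hK.measurableSet fun _ => measurable_of_mem_affFun) fun r _ y => ?_
    rw [Subsingleton.elim (r • y) y]
  | d + 1, K, hK => by
    have := isDiffClosed_paramSmooth.of_polyGen (θ := fun _ => 1)
      (fun C hC => paramSmooth_of_polyGen_linFun hC) ?_ hK.insert_one_of_affFun _ PolyGen.univ
    · simpa using this
    · rintro C hC _ ⟨v, rfl⟩ s
      by_cases hv : v = 0
      · convert paramSmooth_empty (d := d + 1) using 1
        ext y
        cases s <;> simp [hv, cmpRel_true, cmpRel_false]
      · exact paramSmooth_cut (paramSmooth_of_polyGen_affFun d) hC hv s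

end

section directional

variable {E : Type*} [NormedAddCommGroup E] [NormedSpace ℝ E]

/-- The derivative of `M` in the direction `v`, as a function of the point. -/
noncomputable def dirDeriv (v : E) (M : E → ℂ) (x : E) : ℂ := fderiv ℝ M x v

lemma ContDiffOn.dirDeriv {M : E → ℂ} {Ω : Set E} (hΩ : IsOpen Ω) (hM : ContDiffOn ℝ ∞ M Ω)
    (v : E) :
    ContDiffOn ℝ ∞ (dirDeriv v M) Ω :=
  (hM.fderiv_of_isOpen hΩ (m := ∞) (by simp)).clm_apply contDiffOn_const

lemma ContDiffOn.iterate_dirDeriv {M : E → ℂ} {Ω : Set E} (hΩ : IsOpen Ω)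
    (hM : ContDiffOn ℝ ∞ M Ω) (v : E) (k : ℕ) : ContDiffOn ℝ ∞ ((_root_.dirDeriv v)^[k] M) Ω := by
  induction k with
  | zero => exact hM
  | succ k ih =>
    rw [Function.iterate_succ_apply']
    exact ih.dirDeriv hΩ v

lemma dirDeriv_congr {M M' : E → ℂ} {Ω : Set E} (hΩ : IsOpen Ω) (h : Set.EqOn M M' Ω) (v : E) :
    Set.EqOn (dirDeriv v M) (dirDeriv v M') Ω := fun x hx => by
  simp only [dirDeriv, (h.eventuallyEq_of_mem (hΩ.mem_nhds hx)).fderiv_eq]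

lemma dirDeriv_comm {M : E → ℂ} {Ω : Set E} (hΩ : IsOpen Ω) (hM : ContDiffOn ℝ ∞ M Ω) (v w : E) :
    Set.EqOn (dirDeriv v (dirDeriv w M)) (dirDeriv w (dirDeriv v M)) Ω := fun x hx => by
  have hd : DifferentiableAt ℝ (fderiv ℝ M) x :=
    ((hM.fderiv_of_isOpen hΩ (m := ∞) (by simp)).differentiableOn (by simp)).differentiableAt
      (hΩ.mem_nhds hx)
  have key : ∀ u, fderiv ℝ (dirDeriv u M) x = (fderiv ℝ (fderiv ℝ M) x).flip u := fun u => by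
    change fderiv ℝ (fun y => fderiv ℝ M y u) x = _
    rw [fderiv_clm_apply hd (differentiableAt_const u)]
    ext z
    simp
  have hs : IsSymmSndFDerivAt ℝ M x :=
    (hM.contDiffAt (hΩ.mem_nhds hx)).isSymmSndFDerivAt (by
      rw [minSmoothness_of_isRCLikeNormedField]; exact WithTop.coe_le_coe.2 le_top)
  rw [dirDeriv, dirDeriv, key, key]
  exact hs v w

lemma dirDeriv_iterate_comm {M : E → ℂ} {Ω : Set E} (hΩ : IsOpen Ω) (hM : ContDiffOn ℝ ∞ M Ω)
    (v w : E) (k : ℕ) :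
    Set.EqOn (dirDeriv v ((dirDeriv w)^[k] M)) ((dirDeriv w)^[k] (dirDeriv v M)) Ω := by
  induction k with
  | zero => exact fun _ _ => rfl
  | succ k ih =>
    rw [Function.iterate_succ_apply', Function.iterate_succ_apply']
    exact (dirDeriv_comm hΩ (hM.iterate_dirDeriv hΩ w k) v w).trans (dirDeriv_congr hΩ ih w)

lemma ContDiffOn.hasFDerivAt_of_isOpen {M : E → ℂ} {Ω : Set E} (hΩ : IsOpen Ω)
    (hM : ContDiffOn ℝ ∞ M Ω) {x : E} (hx : x ∈ Ω) : HasFDerivAt M (fderiv ℝ M x) x :=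
  ((hM.differentiableOn (by simp)).differentiableAt (hΩ.mem_nhds hx)).hasFDerivAt

lemma ContDiffOn.hasDerivAt_curve {M : E → ℂ} {Ω : Set E} (hΩ : IsOpen Ω)
    (hM : ContDiffOn ℝ ∞ M Ω) {γ : ℝ → E} {v : E} {t : ℝ} (hγ : HasDerivAt γ v t) (h : γ t ∈ Ω) :
    HasDerivAt (fun s => M (γ s)) (_root_.dirDeriv v M (γ t)) t :=
  (hM.hasFDerivAt_of_isOpen hΩ h).comp_hasDerivAt t hγ

/-- Derivatives in a direction tangent to `Z` only depend on the restriction to `Z`. -/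
lemma dirDeriv_congr_of_tangent {M M' : E → ℂ} {Ω : Set E} {Z : Set E} (hΩ : IsOpen Ω)
    (hM : ContDiffOn ℝ ∞ M Ω) (hM' : ContDiffOn ℝ ∞ M' Ω) {v : E}
    (hZ : ∀ x ∈ Z, ∀ᶠ s : ℝ in nhds 0, x + s • v ∈ Z) (h : Set.EqOn M M' (Ω ∩ Z)) :
    Set.EqOn (dirDeriv v M) (dirDeriv v M') (Ω ∩ Z) := fun x hx => by
  have hγ : HasDerivAt (fun s : ℝ => x + s • v) v 0 := by
    simpa using ((hasDerivAt_id (0 : ℝ)).smul_const v).const_add x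
  have hx0 : x + (0 : ℝ) • v = x := by simp
  have h1 := hM.hasDerivAt_curve hΩ hγ (by simpa using hx.1)
  have h2 := hM'.hasDerivAt_curve hΩ hγ (by simpa using hx.1)
  rw [hx0] at h1 h2
  refine h1.unique (h2.congr_of_eventuallyEq ?_)
  have : ∀ᶠ s in nhds (0 : ℝ), x + s • v ∈ Ω :=
    hγ.continuousAt.eventually_mem (by simpa using hΩ.mem_nhds hx.1)
  filter_upwards [this, hZ x hx.2] with s hs hs'
  exact h ⟨hs, hs'⟩

lemma iterate_dirDeriv_congr_of_tangent {M M' : E → ℂ} {Ω : Set E} {Z : Set E} (hΩ : IsOpen Ω)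
    (hM : ContDiffOn ℝ ∞ M Ω) (hM' : ContDiffOn ℝ ∞ M' Ω) {v : E}
    (hZ : ∀ x ∈ Z, ∀ᶠ s : ℝ in nhds 0, x + s • v ∈ Z) (h : Set.EqOn M M' (Ω ∩ Z)) (k : ℕ) :
    Set.EqOn ((dirDeriv v)^[k] M) ((dirDeriv v)^[k] M') (Ω ∩ Z) := by
  induction k with
  | zero => exact h
  | succ k ih =>
    rw [Function.iterate_succ_apply', Function.iterate_succ_apply']
    exact dirDeriv_congr_of_tangent hΩ (hM.iterate_dirDeriv hΩ v k) (hM'.iterate_dirDeriv hΩ v k)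
      hZ ih

end directional

/-- The points `(a, b, t)` with `b > 0` or `a ≠ 0`, and `|t| < δ`. -/
def slitBox (δ : ℝ) : Set (ℝ × ℝ × ℝ) := {x | (0 < x.2.1 ∨ x.1 ≠ 0) ∧ x.2.2 ∈ Set.Ioo (-δ) δ}

lemma isOpen_slitBox (δ : ℝ) : IsOpen (slitBox δ) := by
  refine IsOpen.inter (IsOpen.union ?_ ?_) ?_
  · exact isOpen_lt (f := fun _ : ℝ × ℝ × ℝ => (0 : ℝ)) (g := fun x : ℝ × ℝ × ℝ => x.2.1)
      continuous_const (by fun_prop)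
  · exact isOpen_ne_fun (f := fun x : ℝ × ℝ × ℝ => x.1) (by fun_prop) continuous_const
  · exact isOpen_Ioo.preimage (by fun_prop : Continuous fun x : ℝ × ℝ × ℝ => x.2.2)

/-- Smooth functions of `(a, b, t)` that are homogeneous of degree `0` in `(a, b)` up to a
logarithmic term. -/
structure LogHom (δ : ℝ) (M : ℝ × ℝ × ℝ → ℂ) : Prop where
  smooth : ContDiffOn ℝ ∞ M (slitBox δ)
  scaling : ∀ a b t r : ℝ, (a, b, t) ∈ slitBox δ → t ≠ 0 → 0 < r →
    M (r * a, r * b, t) = M (a, b, t) +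
      (Real.log r : ℂ) * (M (Real.exp 1, 0, t) - M (1, 0, t))

lemma smul_mem_slitBox {δ a b t r : ℝ} (h : (a, b, t) ∈ slitBox δ) (hr : 0 < r) :
    (r * a, r * b, t) ∈ slitBox δ := by
  obtain ⟨h1, h2⟩ := h
  refine ⟨?_, h2⟩
  simpa [hr, hr.ne'] using h1

lemma hasDerivAt_third (a b t : ℝ) : HasDerivAt (fun s : ℝ => (a, b, s)) (0, 0, 1) t :=
  (hasDerivAt_const t a).prodMk ((hasDerivAt_const t b).prodMk (hasDerivAt_id t))

lemma LogHom.dirDeriv {δ : ℝ} {M : ℝ × ℝ × ℝ → ℂ} (hM : LogHom δ M) :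
    LogHom δ (_root_.dirDeriv (0, 0, 1) M) := by
  refine ⟨hM.smooth.dirDeriv (isOpen_slitBox δ) _, fun a b t r hx ht hr => ?_⟩
  have D : ∀ a b, (a, b, t) ∈ slitBox δ → HasDerivAt (fun s => M (a, b, s))
      (_root_.dirDeriv (0, 0, 1) M (a, b, t)) t := fun a b h =>
    hM.smooth.hasDerivAt_curve (isOpen_slitBox δ) (hasDerivAt_third a b t) h
  have e1 : (Real.exp 1, 0, t) ∈ slitBox δ := ⟨Or.inr (Real.exp_ne_zero 1), hx.2⟩
  have e2 : (1, 0, t) ∈ slitBox δ := ⟨Or.inr one_ne_zero, hx.2⟩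
  refine (D _ _ (smul_mem_slitBox hx hr)).unique (HasDerivAt.congr_of_eventuallyEq
    ((D _ _ hx).add (((D _ _ e1).sub (D _ _ e2)).const_mul (Real.log r : ℂ))) ?_)
  filter_upwards [isOpen_Ioo.mem_nhds hx.2, isOpen_ne.mem_nhds ht] with s hs hs0
  exact hM.scaling a b s r ⟨hx.1, hs⟩ hs0 hr

lemma ContDiffOn.continuousOn_diagonal {δ δ₀ : ℝ} (hδ : δ₀ < δ) {M : ℝ × ℝ × ℝ → ℂ}
    (hM : ContDiffOn ℝ ∞ M (slitBox δ)) {ε : ℝ} (hε : 0 < ε) :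
    ContinuousOn (fun t => M (t, ε, t)) (Set.Icc (-δ₀) δ₀) :=
  hM.continuousOn.comp (by fun_prop) fun t ht =>
    ⟨Or.inl hε, by linarith [ht.1], by linarith [ht.2]⟩

lemma LogHom.tendsto_integral {δ δ₀ : ℝ} (h₀ : 0 < δ₀) (hδ : δ₀ < δ) {M : ℝ × ℝ × ℝ → ℂ}
    (hM : LogHom δ M) :
    Tendsto (fun ε : ℝ => ∫ t in -δ₀..δ₀, M (t, ε, t)) (nhdsWithin 0 (Set.Ioi 0))
      (nhds (∫ t in -δ₀..δ₀, M (t, 0, t))) := by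
  have hle : -δ₀ ≤ δ₀ := by linarith
  obtain ⟨C, hC⟩ : ∃ C, ∀ a b t : ℝ, a ^ 2 + b ^ 2 = 1 → 0 ≤ b → t ∈ Set.Icc (-δ₀) δ₀ →
      ‖M (a, b, t)‖ ≤ C := by
    have hK : IsCompact (({x : ℝ × ℝ | x.1 ^ 2 + x.2 ^ 2 = 1 ∧ 0 ≤ x.2}) ×ˢ
        Set.Icc (-δ₀) δ₀) := by
      refine IsCompact.prod (isCompact_of_isClosed_isBounded ?_ ?_) isCompact_Icc
      · exact (isClosed_eq (f := fun x : ℝ × ℝ => x.1 ^ 2 + x.2 ^ 2) (by fun_prop)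
          continuous_const).inter (isClosed_le (f := fun _ : ℝ × ℝ => (0 : ℝ)) continuous_const
            continuous_snd)
      · refine (isBounded_iff_forall_norm_le).2 ⟨1, fun x hx => ?_⟩
        rw [Prod.norm_def, Real.norm_eq_abs, Real.norm_eq_abs]
        have hx1 : x.1 ^ 2 + x.2 ^ 2 = 1 := hx.1
        exact max_le (abs_le_one_iff_mul_self_le_one.2 (by nlinarith [sq_nonneg x.2]))
          (abs_le_one_iff_mul_self_le_one.2 (by nlinarith [sq_nonneg x.1]))
    obtain ⟨C, hC⟩ := hK.exists_bound_of_continuousOn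
      (f := fun x : (ℝ × ℝ) × ℝ => M (x.1.1, x.1.2, x.2))
      (hM.smooth.continuousOn.comp (by fun_prop) fun x hx => by
        refine ⟨?_, by linarith [hx.2.1], by linarith [hx.2.2]⟩
        rcases hx.1.2.lt_or_eq with h | h
        · exact Or.inl h
        · refine Or.inr fun h' => ?_
          have := hx.1.1
          simp only at h'
          rw [h', ← h] at this
          norm_num at this)
    exact ⟨C, fun a b t h1 h2 h3 => hC ((a, b), t) ⟨⟨h1, h2⟩, h3⟩⟩
  obtain ⟨C', hC'⟩ : ∃ C', ∀ t ∈ Set.Icc (-δ₀) δ₀,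
      ‖M (Real.exp 1, 0, t) - M (1, 0, t)‖ ≤ C' := by
    refine isCompact_Icc.exists_bound_of_continuousOn (ContinuousOn.sub ?_ ?_)
    · exact hM.smooth.continuousOn.comp (by fun_prop) fun t ht =>
        ⟨Or.inr (Real.exp_ne_zero 1), by linarith [ht.1], by linarith [ht.2]⟩
    · exact hM.smooth.continuousOn.comp (by fun_prop) fun t ht =>
        ⟨Or.inr one_ne_zero, by linarith [ht.1], by linarith [ht.2]⟩
  have hC'0 : 0 ≤ C' := (norm_nonneg _).trans (hC' 0 ⟨by linarith, h₀.le⟩)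
  set R : ℝ := √(δ₀ ^ 2 + 1)
  refine intervalIntegral.tendsto_integral_filter_of_dominated_convergence
    (fun t => C + (|Real.log t| + |Real.log R|) * C') ?_ ?_ ?_ ?_
  · filter_upwards [self_mem_nhdsWithin] with ε hε
    rw [Set.uIoc_of_le hle]
    exact ((hM.smooth.continuousOn_diagonal hδ hε).mono
      Set.Ioc_subset_Icc_self).aestronglyMeasurable measurableSet_Ioc
  · filter_upwards [Ioo_mem_nhdsGT (zero_lt_one' ℝ)] with ε hε
    have hne : ∀ᵐ t : ℝ, t ≠ 0 := by simp [ae_iff]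
    filter_upwards [hne] with t ht0 ht
    rw [Set.uIoc_of_le hle] at ht
    have ht' : t ∈ Set.Icc (-δ₀) δ₀ := Set.Ioc_subset_Icc_self ht
    set ρ : ℝ := √(t ^ 2 + ε ^ 2)
    have hsum : 0 < t ^ 2 + ε ^ 2 := by positivity
    have hρ : 0 < ρ := Real.sqrt_pos.2 hsum
    have hρ2 : ρ ^ 2 = t ^ 2 + ε ^ 2 := Real.sq_sqrt hsum.le
    have hs := hM.scaling (t / ρ) (ε / ρ) t ρ
      ⟨Or.inl (div_pos hε.1 hρ), by linarith [ht'.1], by linarith [ht'.2]⟩ ht0 hρ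
    rw [mul_div_cancel₀ _ hρ.ne', mul_div_cancel₀ _ hρ.ne'] at hs
    rw [hs]
    have hlog : |Real.log ρ| ≤ |Real.log t| + |Real.log R| := by
      have l1 : Real.log t ≤ Real.log ρ := by
        rw [← Real.log_abs]
        exact Real.log_le_log (abs_pos.2 ht0) (Real.abs_le_sqrt (by nlinarith [sq_nonneg ε]))
      have l2 : Real.log ρ ≤ Real.log R := by
        refine Real.log_le_log hρ (Real.sqrt_le_sqrt ?_)
        nlinarith [ht'.1, ht'.2, hε.1, hε.2]
      rw [abs_le]
      constructor
      · linarith [neg_abs_le (Real.log t), abs_nonneg (Real.log R)]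
      · linarith [le_abs_self (Real.log R), abs_nonneg (Real.log t)]
    refine (norm_add_le _ _).trans (add_le_add (hC _ _ _ ?_ (div_pos hε.1 hρ).le ht') ?_)
    · rw [div_pow, div_pow, ← add_div, ← hρ2, div_self (by positivity)]
    · rw [norm_mul, Complex.norm_real, Real.norm_eq_abs]
      gcongr
      exact hC' t ht'
  · exact intervalIntegrable_const.add
      ((intervalIntegral.intervalIntegrable_log'.abs.add intervalIntegrable_const).mul_const C')
  · have hne : ∀ᵐ t : ℝ, t ≠ 0 := by simp [ae_iff]
    filter_upwards [hne] with t ht0 ht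
    rw [Set.uIoc_of_le hle] at ht
    have hc : ContinuousAt M (t, 0, t) := hM.smooth.continuousOn.continuousAt
      ((isOpen_slitBox δ).mem_nhds ⟨Or.inr ht0, by linarith [ht.1], by linarith [ht.2]⟩)
    have hc2 : ContinuousAt (fun ε : ℝ => M (t, ε, t)) 0 :=
      ContinuousAt.comp (f := fun ε : ℝ => (t, ε, t)) hc (by fun_prop)
    exact hc2.tendsto.mono_left nhdsWithin_le_nhds

lemma LogHom.tendsto_integral_iterate_dirDeriv {δ δ₀ : ℝ} (h₀ : 0 < δ₀) (hδ : δ₀ < δ) (k : ℕ) :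
    ∀ {M M' : ℝ × ℝ × ℝ → ℂ}, LogHom δ M → LogHom δ M' →
    Set.EqOn M M' (slitBox δ ∩ {x | x.2.1 = 0 ∧ x.2.2 ≠ 0}) → ∃ L : ℂ,
      Tendsto (fun ε : ℝ => ∫ t in -δ₀..δ₀, (_root_.dirDeriv (1, 0, 0))^[k] M (t, ε, t))
        (nhdsWithin 0 (Set.Ioi 0)) (nhds L) ∧
      Tendsto (fun ε : ℝ => ∫ t in -δ₀..δ₀, (_root_.dirDeriv (1, 0, 0))^[k] M' (t, ε, t))
        (nhdsWithin 0 (Set.Ioi 0)) (nhds L) := by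
  have hle : -δ₀ ≤ δ₀ := by linarith
  have hΩ := isOpen_slitBox δ
  induction k with
  | zero =>
    intro M M' hM hM' h
    refine ⟨_, hM.tendsto_integral h₀ hδ, ?_⟩
    rw [intervalIntegral.integral_congr_ae (g := fun t => M' (t, 0, t))]
    · exact hM'.tendsto_integral h₀ hδ
    · have hne : ∀ᵐ t : ℝ, t ≠ 0 := by simp [ae_iff]
      filter_upwards [hne] with t ht0 ht
      rw [Set.uIoc_of_le hle] at ht
      exact h ⟨⟨Or.inr ht0, by linarith [ht.1], by linarith [ht.2]⟩, rfl, ht0⟩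
  | succ k ih =>
    intro M M' hM hM' h
    have byParts : ∀ {M : ℝ × ℝ × ℝ → ℂ}, LogHom δ M → ∀ ε : ℝ, 0 < ε →
        ∫ t in -δ₀..δ₀, (_root_.dirDeriv (1, 0, 0))^[k + 1] M (t, ε, t) =
          (_root_.dirDeriv (1, 0, 0))^[k] M (δ₀, ε, δ₀) -
          (_root_.dirDeriv (1, 0, 0))^[k] M (-δ₀, ε, -δ₀) -
          ∫ t in -δ₀..δ₀, (_root_.dirDeriv (1, 0, 0))^[k] (_root_.dirDeriv (0, 0, 1) M)
            (t, ε, t) := by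
      intro M hM ε hε
      have hs := hM.smooth.iterate_dirDeriv hΩ (1, 0, 0) k
      have i1 : IntervalIntegrable (fun t => (_root_.dirDeriv (1, 0, 0))^[k + 1] M (t, ε, t))
          volume (-δ₀) δ₀ := ContinuousOn.intervalIntegrable_of_Icc hle
        ((hM.smooth.iterate_dirDeriv hΩ (1, 0, 0) (k + 1)).continuousOn_diagonal hδ hε)
      have i2 : IntervalIntegrable (fun t => (_root_.dirDeriv (1, 0, 0))^[k]
          (_root_.dirDeriv (0, 0, 1) M) (t, ε, t)) volume (-δ₀) δ₀ :=
        ContinuousOn.intervalIntegrable_of_Icc hle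
          ((hM.dirDeriv.smooth.iterate_dirDeriv hΩ (1, 0, 0) k).continuousOn_diagonal hδ hε)
      rw [eq_sub_iff_add_eq, ← intervalIntegral.integral_add i1 i2]
      refine intervalIntegral.integral_eq_sub_of_hasDerivAt
        (f := fun t => (_root_.dirDeriv (1, 0, 0))^[k] M (t, ε, t)) (fun t ht => ?_) (i1.add i2)
      rw [Set.uIcc_of_le hle] at ht
      have hmem : (t, ε, t) ∈ slitBox δ :=
        ⟨Or.inl hε, by linarith [ht.1], by linarith [ht.2]⟩
      have hγ : HasDerivAt (fun s : ℝ => (s, ε, s)) (1, 0, 1) t :=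
        (hasDerivAt_id t).prodMk ((hasDerivAt_const t ε).prodMk (hasDerivAt_id t))
      refine (hs.hasDerivAt_curve hΩ hγ hmem).congr_deriv ?_
      rw [← dirDeriv_iterate_comm hΩ hM.smooth _ _ _ hmem, Function.iterate_succ_apply']
      simp only [_root_.dirDeriv]
      rw [← map_add]
      simp
    have hbd : ∀ {M : ℝ × ℝ × ℝ → ℂ}, LogHom δ M → ∀ t, t ≠ 0 → t ∈ Set.Icc (-δ₀) δ₀ →
        Tendsto (fun ε : ℝ => (_root_.dirDeriv (1, 0, 0))^[k] M (t, ε, t))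
          (nhdsWithin 0 (Set.Ioi 0)) (nhds ((_root_.dirDeriv (1, 0, 0))^[k] M (t, 0, t))) := by
      intro M hM t ht0 ht
      have hc : ContinuousAt ((_root_.dirDeriv (1, 0, 0))^[k] M) (t, 0, t) :=
        (hM.smooth.iterate_dirDeriv hΩ (1, 0, 0) k).continuousOn.continuousAt
        (hΩ.mem_nhds ⟨Or.inr ht0, by linarith [ht.1], by linarith [ht.2]⟩)
      have hc2 := ContinuousAt.comp (f := fun ε : ℝ => (t, ε, t)) (x := 0) hc (by fun_prop)
      exact hc2.tendsto.mono_left nhdsWithin_le_nhds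
    obtain ⟨L, hL, hL'⟩ := ih hM.dirDeriv hM'.dirDeriv
      (dirDeriv_congr_of_tangent hΩ hM.smooth hM'.smooth (by
        rintro x ⟨hx, hx'⟩
        have : ∀ᶠ s : ℝ in nhds 0, x.2.2 + s ≠ 0 :=
          ContinuousAt.eventually_ne (by fun_prop) (by simpa using hx')
        filter_upwards [this] with s hs
        exact ⟨by simpa using hx, by simpa using hs⟩) h)
    have hcongr := iterate_dirDeriv_congr_of_tangent (v := ((1, 0, 0) : ℝ × ℝ × ℝ)) hΩ hM.smooth
      hM'.smooth (by rintro x ⟨hx, hx'⟩; exact Eventually.of_forall fun s => by simp [hx, hx']) h k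
    have m1 : δ₀ ∈ Set.Icc (-δ₀) δ₀ := ⟨hle, le_rfl⟩
    have m2 : -δ₀ ∈ Set.Icc (-δ₀) δ₀ := ⟨le_rfl, hle⟩
    have e1 := hcongr (x := (δ₀, 0, δ₀)) ⟨⟨Or.inr h₀.ne', by linarith, hδ⟩, rfl, h₀.ne'⟩
    have e2 := hcongr (x := (-δ₀, 0, -δ₀)) ⟨⟨Or.inr (neg_ne_zero.2 h₀.ne'), by
      linarith, by linarith⟩, rfl, neg_ne_zero.2 h₀.ne'⟩
    have t1 := ((hbd hM _ h₀.ne' m1).sub (hbd hM _ (neg_ne_zero.2 h₀.ne') m2)).sub hL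
    have t2 := ((hbd hM' _ h₀.ne' m1).sub (hbd hM' _ (neg_ne_zero.2 h₀.ne') m2)).sub hL'
    rw [← e1, ← e2] at t2
    refine ⟨_, t1.congr' ?_, t2.congr' ?_⟩
    · filter_upwards [self_mem_nhdsWithin] with ε hε
      exact (byParts hM ε hε).symm
    · filter_upwards [self_mem_nhdsWithin] with ε hε
      exact (byParts hM' ε hε).symm

/-- The `k`-th derivative of the complex logarithm. -/
noncomputable def logKer : ℕ → ℂ → ℂ
  | 0, z => Complex.log z
  | k + 1, z => (-1) ^ k * (k.factorial : ℂ) * z ^ (-((k + 1 : ℕ) : ℤ))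

lemma hasDerivAt_logKer (k : ℕ) {z : ℂ} (hz : z ∈ Complex.slitPlane) :
    HasDerivAt (logKer k) (logKer (k + 1) z) z := by
  cases k with
  | zero =>
    refine (Complex.hasDerivAt_log hz).congr_deriv ?_
    simp [logKer]
  | succ k =>
    have h := (hasDerivAt_zpow (-((k + 1 : ℕ) : ℤ)) z
      (Or.inl (Complex.slitPlane_ne_zero hz))).const_mul ((-1 : ℂ) ^ k * (k.factorial : ℂ))
    refine h.congr_deriv ?_
    have e : (-((k + 1 : ℕ) : ℤ)) - 1 = -((k + 1 + 1 : ℕ) : ℤ) := by push_cast; ring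
    simp only [logKer]
    rw [e, Nat.factorial_succ]
    push_cast
    ring

lemma add_mul_I_mem_slitPlane {a h : ℝ} (h0 : 0 < h ∨ a ≠ 0) :
    (a : ℂ) * Complex.I + h ∈ Complex.slitPlane := by
  rw [Complex.mem_slitPlane_iff]
  simpa using h0

lemma hasDerivAt_logKer_line (k : ℕ) {a h : ℝ} (h0 : 0 < h ∨ a ≠ 0) :
    HasDerivAt (fun s : ℝ => logKer k ((s : ℂ) * Complex.I + h))
      (Complex.I * logKer (k + 1) ((a : ℂ) * Complex.I + h)) a := by
  have h1 : HasDerivAt (fun s : ℝ => (s : ℂ) * Complex.I + h) Complex.I a := by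
    simpa using (Complex.ofRealCLM.hasDerivAt.mul_const Complex.I).add_const (h : ℂ)
  have := (hasDerivAt_logKer k (add_mul_I_mem_slitPlane h0)).comp a h1
  rw [mul_comm]
  exact this

section

variable {d : ℕ}

lemma continuous_logKer_line {X : Type*} [TopologicalSpace X] {h : X → ℝ} (hc : Continuous h)
    (h0 : ∀ y, 0 < h y) (k : ℕ) (a : ℝ) :
    Continuous fun y => logKer k ((a : ℂ) * Complex.I + h y) := by
  rw [continuous_iff_continuousAt]
  intro y
  refine ContinuousAt.comp (g := logKer k) (f := fun y => (a : ℂ) * Complex.I + h y)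
    (hasDerivAt_logKer k (add_mul_I_mem_slitPlane (Or.inl (h0 y)))).continuousAt ?_
  exact Continuous.continuousAt (by fun_prop)

lemma hasDerivAt_integral_logKer {D : Set (EuclideanSpace ℝ (Fin d))} (hD : MeasurableSet D)
    (hDb : Bornology.IsBounded D) {h : EuclideanSpace ℝ (Fin d) → ℝ} (hc : Continuous h)
    (h0 : ∀ y, 0 < h y) (k : ℕ) (a : ℝ) :
    HasDerivAt (fun s : ℝ => ∫ y in D, logKer k ((s : ℂ) * Complex.I + h y))
      (Complex.I * ∫ y in D, logKer (k + 1) ((a : ℂ) * Complex.I + h y)) a := by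
  obtain ⟨C, hC⟩ := hDb.isCompact_closure.exists_bound_of_continuousOn (f := fun y => (h y)⁻¹)
    (hc.inv₀ fun y => (h0 y).ne').continuousOn
  have hfin : IsFiniteMeasure (volume.restrict D) :=
    isFiniteMeasure_restrict.2 hDb.measure_lt_top.ne
  rw [← integral_const_mul]
  refine (hasDerivAt_integral_of_dominated_loc_of_deriv_le (μ := volume.restrict D)
    (𝕜 := ℝ) (x₀ := a) (F := fun (s : ℝ) y => logKer k ((s : ℂ) * Complex.I + h y))
    (F' := fun (s : ℝ) y => Complex.I * logKer (k + 1) ((s : ℂ) * Complex.I + h y))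
    (s := (Set.univ : Set ℝ)) (bound := fun _ => (k.factorial : ℝ) * C ^ (k + 1)) univ_mem
    ?_ ?_ ?_ ?_ ?_ ?_).2
  · exact Eventually.of_forall fun s => (continuous_logKer_line hc h0 k s).aestronglyMeasurable
  · exact (continuous_logKer_line hc h0 k a).integrableOn_of_isBounded hDb
  · exact (continuous_const.mul (continuous_logKer_line hc h0 (k + 1) a)).aestronglyMeasurable
  · refine (ae_restrict_mem hD).mono fun y hy s _ => ?_
    have hle : h y ≤ ‖(s : ℂ) * Complex.I + h y‖ := by
      have := Complex.abs_re_le_norm ((s : ℂ) * Complex.I + h y)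
      simp only [Complex.add_re, Complex.mul_re, Complex.ofReal_re, Complex.I_re, mul_zero,
        Complex.ofReal_im, Complex.I_im, mul_one, sub_self, zero_add] at this
      exact (le_abs_self _).trans this
    have hCy : (h y)⁻¹ ≤ C := (le_abs_self _).trans (hC y (subset_closure hy))
    simp only [logKer, norm_mul, Complex.norm_I, one_mul, norm_pow, norm_neg, norm_one, one_pow,
      zpow_neg, zpow_natCast, norm_inv, Complex.norm_natCast]
    gcongr
    rw [← inv_pow]
    gcongr
    exact (inv_anti₀ (h0 y) hle).trans hCy
  · exact integrable_const _
  · exact Eventually.of_forall fun y s _ => hasDerivAt_logKer_line k (Or.inl (h0 y))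

/-- The derivatives in `a` of a function which is the integral of `log (a i + b H)`. -/
lemma iterate_dirDeriv_eq_integral_logKer {δ : ℝ} {M : ℝ × ℝ × ℝ → ℂ}
    (hM : ContDiffOn ℝ ∞ M (slitBox δ)) {t b : ℝ} (ht : t ∈ Set.Ioo (-δ) δ) (hb : 0 < b)
    {D : Set (EuclideanSpace ℝ (Fin d))} (hD : MeasurableSet D)
    (hDb : Bornology.IsBounded D) {h : EuclideanSpace ℝ (Fin d) → ℝ} (hc : Continuous h)
    (h0 : ∀ y, 0 < h y)
    (hMD : ∀ a : ℝ, M (a, b, t) = ∫ y in D, Complex.log ((a : ℂ) * Complex.I + (b * h y : ℝ)))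
    (k : ℕ) : ∀ a : ℝ, (dirDeriv (1, 0, 0))^[k] M (a, b, t) =
      Complex.I ^ k * ∫ y in D, logKer k ((a : ℂ) * Complex.I + (b * h y : ℝ)) := by
  induction k with
  | zero => simpa [logKer] using hMD
  | succ k ih =>
    intro a
    have hγ : HasDerivAt (fun s : ℝ => (s, b, t)) (1, 0, 0) a :=
      (hasDerivAt_id a).prodMk ((hasDerivAt_const a b).prodMk (hasDerivAt_const a t))
    have h1 := (hM.iterate_dirDeriv (isOpen_slitBox δ) (1, 0, 0) k).hasDerivAt_curve
      (isOpen_slitBox δ) hγ ⟨Or.inl hb, ht⟩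
    have h2 := (hasDerivAt_integral_logKer hD hDb (h := fun y => b * h y) (by fun_prop)
      (fun y => mul_pos hb (h0 y)) k a).const_mul (Complex.I ^ k)
    simp only [ih] at h1
    rw [Function.iterate_succ_apply', h1.unique h2, pow_succ]
    ring

lemma contDiffOn_log_line {H : EuclideanSpace ℝ (Fin (d + 1)) → ℝ} (hH : ContDiff ℝ ∞ H)
    (hpos : ∀ x, 0 < H x) :
    ContDiffOn ℝ ∞ (fun q : (ℝ × ℝ × ℝ) × EuclideanSpace ℝ (Fin d) =>
      Complex.log ((q.1.1 : ℂ) * Complex.I + (q.1.2.1 * H (consE q.1.2.2 q.2) : ℝ)))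
      ({x | 0 < x.2.1 ∨ x.1 ≠ 0} ×ˢ Set.univ) := by
  intro q hq
  refine ContDiffAt.contDiffWithinAt ?_
  have h1 : q.1.2.1 * H (consE q.1.2.2 q.2) > 0 ∨ q.1.1 ≠ 0 :=
    hq.1.imp (fun h => mul_pos h (hpos _)) id
  have h2 := (Complex.contDiffAt_log (n := ∞) (add_mul_I_mem_slitPlane h1)).restrict_scalars ℝ
  refine ContDiffAt.comp (g := Complex.log) (f := fun q : (ℝ × ℝ × ℝ) × EuclideanSpace ℝ (Fin d) =>
    (q.1.1 : ℂ) * Complex.I + (q.1.2.1 * H (consE q.1.2.2 q.2) : ℝ)) q h2 (ContDiff.contDiffAt ?_)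
  have h3 : ContDiff ℝ ∞ fun q : (ℝ × ℝ × ℝ) × EuclideanSpace ℝ (Fin d) =>
      q.1.2.1 * H (consE q.1.2.2 q.2) := by
    refine ContDiff.mul (by fun_prop) (hH.comp (contDiff_consE.comp (f := fun q :
      (ℝ × ℝ × ℝ) × EuclideanSpace ℝ (Fin d) => (q.1.2.2, q.2)) (by fun_prop)))
  have h4 : ContDiff ℝ ∞ fun q : (ℝ × ℝ × ℝ) × EuclideanSpace ℝ (Fin d) => (q.1.1 : ℂ) :=
    Complex.ofRealCLM.contDiff.comp (by fun_prop)
  exact (h4.mul contDiff_const).add (Complex.ofRealCLM.contDiff.comp h3)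

lemma exists_logHom {K : Set (EuclideanSpace ℝ (Fin d))} (hK : ParamSmooth K) (τ₀ : ℝ) :
    ∃ δ > 0, ∀ H : EuclideanSpace ℝ (Fin (d + 1)) → ℝ, ContDiff ℝ ∞ H → (∀ x, 0 < H x) →
      ∃ M, LogHom δ M ∧ ∀ a b t : ℝ, (a, b, t) ∈ slitBox δ → t ≠ 0 →
        M (a, b, t) = ∫ y in K ∩ {y | ‖y‖ ^ 2 ≤ τ₀ - t ^ 2},
          Complex.log ((a : ℂ) * Complex.I + (b * H (consE t y) : ℝ)) := by
  obtain ⟨hKm, h⟩ := hK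
  obtain ⟨δ, hδ, h⟩ := h τ₀
  refine ⟨√δ, Real.sqrt_pos.2 hδ, fun H hH hpos => ?_⟩
  have hU : IsOpen {x : ℝ × ℝ × ℝ | 0 < x.2.1 ∨ x.1 ≠ 0} :=
    (isOpen_lt (f := fun _ : ℝ × ℝ × ℝ => (0 : ℝ)) (g := fun x : ℝ × ℝ × ℝ => x.2.1)
      continuous_const (by fun_prop)).union
      (isOpen_ne_fun (f := fun x : ℝ × ℝ × ℝ => x.1) (by fun_prop) continuous_const)
  have hlog := contDiffOn_log_line hH hpos
  obtain ⟨F, hF, e⟩ := h _ _ hU _ hlog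
  have ht2 : ∀ t ∈ Set.Ioo (-√δ) √δ, t ^ 2 < δ := fun t ht => by
    rw [← Real.sq_sqrt hδ.le]
    exact sq_lt_sq.2 (by rw [abs_of_nonneg (Real.sqrt_nonneg δ)]; exact abs_lt.2 ht)
  have hval : ∀ a b t : ℝ, (a, b, t) ∈ slitBox √δ → t ≠ 0 →
      F ((a, b, t), τ₀ - t ^ 2) = ∫ y in K ∩ {y | ‖y‖ ^ 2 ≤ τ₀ - t ^ 2},
        Complex.log ((a : ℂ) * Complex.I + (b * H (consE t y) : ℝ)) := fun a b t hx ht => by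
    have h1 := ht2 t hx.2
    have h2 : 0 < t ^ 2 := by positivity
    exact (e (a, b, t) hx.1 _ ⟨by linarith, by linarith⟩).symm
  refine ⟨fun x => F (x, τ₀ - x.2.2 ^ 2), ⟨?_, ?_⟩, hval⟩
  · refine hF.comp (g := F) (f := fun x : ℝ × ℝ × ℝ => (x, τ₀ - x.2.2 ^ 2)) (by fun_prop)
      fun x hx => ⟨hx.1, ?_⟩
    have := ht2 _ hx.2
    constructor <;> simp only <;> nlinarith [sq_nonneg x.2.2]
  · intro a b t r hx ht hr
    simp only
    have e1 : (Real.exp 1, 0, t) ∈ slitBox √δ := ⟨Or.inr (Real.exp_ne_zero 1), hx.2⟩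
    have e2 : (1, 0, t) ∈ slitBox √δ := ⟨Or.inr one_ne_zero, hx.2⟩
    rw [hval _ _ _ (smul_mem_slitBox hx hr) ht, hval _ _ _ hx ht, hval _ _ _ e1 ht,
      hval _ _ _ e2 ht]
    set D := K ∩ {y : EuclideanSpace ℝ (Fin d) | ‖y‖ ^ 2 ≤ τ₀ - t ^ 2}
    have hDb : Bornology.IsBounded D := (isBounded_norm_sq_le _).subset Set.inter_subset_right
    have hintg : ∀ a b, (a, b, t) ∈ slitBox √δ → IntegrableOn
        (fun y => Complex.log ((a : ℂ) * Complex.I + (b * H (consE t y) : ℝ))) D := fun a b h =>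
      (continuous_section hlog (p := (a, b, t)) h.1).integrableOn_of_isBounded hDb
    have hintg' : IntegrableOn (fun y => (Real.log r : ℂ) *
        (Complex.log (((Real.exp 1 : ℝ) : ℂ) * Complex.I + (0 * H (consE t y) : ℝ)) -
          Complex.log (((1 : ℝ) : ℂ) * Complex.I + (0 * H (consE t y) : ℝ)))) D :=
      ((hintg _ _ e1).sub (hintg _ _ e2)).const_mul _
    rw [← integral_sub (hintg _ _ e1) (hintg _ _ e2), ← integral_const_mul, ← integral_add
      (hintg _ _ hx) hintg']
    refine integral_congr_ae (Eventually.of_forall fun y => ?_)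
    have hne : (a : ℂ) * Complex.I + (b * H (consE t y) : ℝ) ≠ 0 :=
      Complex.slitPlane_ne_zero (add_mul_I_mem_slitPlane
        (hx.1.imp (fun h => mul_pos h (hpos _)) id))
    have l1 := Complex.log_ofReal_mul hr hne
    have l2 := Complex.log_ofReal_mul (Real.exp_pos 1) Complex.I_ne_zero
    simp only [zero_mul, Complex.ofReal_zero, add_zero, l2, Complex.ofReal_one, one_mul,
      Real.log_exp, add_sub_cancel_right, mul_one]
    refine Eq.trans ?_ (l1.trans (add_comm _ _))
    push_cast
    ring_nf

lemma zpow_rotate (n : ℕ) (t h : ℝ) :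
    Complex.I ^ n * ((t : ℂ) * Complex.I + h) ^ (-(n : ℤ)) =
      ((t : ℂ) - h * Complex.I) ^ (-(n : ℤ)) := by
  have : (t : ℂ) * Complex.I + h = Complex.I * ((t : ℂ) - h * Complex.I) := by
    ring_nf
    simp [Complex.I_sq]
  rw [this, mul_zpow, ← mul_assoc, zpow_neg, zpow_natCast,
    mul_inv_cancel₀ (pow_ne_zero _ Complex.I_ne_zero), one_mul]

/-- The contribution of the slab `|t| ≤ δ₀` has a limit which does not depend on `H`. -/
lemma exists_tendsto_slab {K : Set (EuclideanSpace ℝ (Fin d))} (hK : ParamSmooth K) (τ₀ : ℝ)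
    (k : ℕ) : ∃ δ₀ > 0, ∀ H H' : EuclideanSpace ℝ (Fin (d + 1)) → ℝ, ContDiff ℝ ∞ H →
      (∀ x, 0 < H x) → ContDiff ℝ ∞ H' → (∀ x, 0 < H' x) → ∃ L : ℂ,
      Tendsto (fun ε : ℝ => ∫ t in -δ₀..δ₀, ∫ y in K ∩ {y | ‖y‖ ^ 2 ≤ τ₀ - t ^ 2},
        ((t : ℂ) - (ε * H (consE t y) : ℝ) * Complex.I) ^ (-((k + 1 : ℕ) : ℤ)))
        (nhdsWithin 0 (Set.Ioi 0)) (nhds L) ∧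
      Tendsto (fun ε : ℝ => ∫ t in -δ₀..δ₀, ∫ y in K ∩ {y | ‖y‖ ^ 2 ≤ τ₀ - t ^ 2},
        ((t : ℂ) - (ε * H' (consE t y) : ℝ) * Complex.I) ^ (-((k + 1 : ℕ) : ℤ)))
        (nhdsWithin 0 (Set.Ioi 0)) (nhds L) := by
  obtain ⟨δ, hδ, h⟩ := exists_logHom hK τ₀
  refine ⟨δ / 2, half_pos hδ, fun H H' hH hpos hH' hpos' => ?_⟩
  obtain ⟨M, hM, e⟩ := h H hH hpos
  obtain ⟨M', hM', e'⟩ := h H' hH' hpos'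
  obtain ⟨L, hL, hL'⟩ := LogHom.tendsto_integral_iterate_dirDeriv (half_pos hδ) (half_lt_self hδ)
    (k + 1) hM hM' (by
      rintro ⟨a, b, t⟩ ⟨hx, hb, ht⟩
      simp only at hb ht
      rw [e _ _ _ hx ht, e' _ _ _ hx ht]
      simp [hb])
  set c : ℂ := (-1) ^ k * (k.factorial : ℂ)
  have hc : c ≠ 0 := mul_ne_zero (pow_ne_zero _ (by norm_num))
    (Nat.cast_ne_zero.2 k.factorial_ne_zero)
  have key : ∀ (H : EuclideanSpace ℝ (Fin (d + 1)) → ℝ), ContDiff ℝ ∞ H → (∀ x, 0 < H x) →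
      ∀ M, LogHom δ M → (∀ a b t : ℝ, (a, b, t) ∈ slitBox δ → t ≠ 0 →
        M (a, b, t) = ∫ y in K ∩ {y | ‖y‖ ^ 2 ≤ τ₀ - t ^ 2},
          Complex.log ((a : ℂ) * Complex.I + (b * H (consE t y) : ℝ))) → ∀ ε : ℝ, 0 < ε →
      c⁻¹ * ∫ t in -(δ / 2)..(δ / 2), (dirDeriv (1, 0, 0))^[k + 1] M (t, ε, t) =
      ∫ t in -(δ / 2)..(δ / 2), ∫ y in K ∩ {y | ‖y‖ ^ 2 ≤ τ₀ - t ^ 2},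
        ((t : ℂ) - (ε * H (consE t y) : ℝ) * Complex.I) ^ (-((k + 1 : ℕ) : ℤ)) := by
    intro H hH hpos M hM e ε hε
    rw [← intervalIntegral.integral_const_mul]
    refine intervalIntegral.integral_congr_ae ?_
    have hne : ∀ᵐ t : ℝ, t ≠ 0 := by simp [ae_iff]
    filter_upwards [hne] with t ht0 ht
    rw [Set.uIoc_of_le (by linarith)] at ht
    have ht' : t ∈ Set.Ioo (-δ) δ := ⟨by linarith [ht.1], by linarith [ht.2]⟩
    rw [iterate_dirDeriv_eq_integral_logKer hM.smooth ht' hε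
      (hK.1.inter (measurableSet_norm_sq_le (τ₀ - t ^ 2)))
      ((isBounded_norm_sq_le _).subset Set.inter_subset_right) (h := fun y => H (consE t y))
      (hH.continuous.comp ((contDiff_consE (k := 0)).continuous.comp
        (continuous_const.prodMk continuous_id))) (fun y => hpos _)
      (fun a => e a ε t ⟨Or.inl hε, ht'⟩ ht0) (k + 1) t, ← integral_const_mul,
      ← integral_const_mul]
    refine integral_congr_ae (Eventually.of_forall fun y => ?_)
    simp only [logKer]
    rw [← zpow_rotate]
    change c⁻¹ * (_ * (c * _)) = _
    field_simp
  refine ⟨c⁻¹ * L, (hL.const_mul c⁻¹).congr' ?_, (hL'.const_mul c⁻¹).congr' ?_⟩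
  · filter_upwards [self_mem_nhdsWithin] with ε hε using key H hH hpos M hM e ε hε
  · filter_upwards [self_mem_nhdsWithin] with ε hε using key H' hH' hpos' M' hM' e' ε hε

end

section

variable {d : ℕ}

/-- The affine functions on `ℝ^(d+1)` which do not depend on the first coordinate. -/
def horFun (d : ℕ) : Set (EuclideanSpace ℝ (Fin (d + 1)) → ℝ) :=
  {ℓ | ∃ (a : ℝ) (v : _), v 0 = 0 ∧ ℓ = fun x => a + inner ℝ v x}

/-- The integrand `(x₀ - ε H(x) i)^{-(d+1)}`. -/
noncomputable def dhKer (H : EuclideanSpace ℝ (Fin (d + 1)) → ℝ) (ε : ℝ)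
    (x : EuclideanSpace ℝ (Fin (d + 1))) : ℂ :=
  ((x 0 : ℂ) - (ε * H x : ℝ) * Complex.I) ^ (-((d + 1 : ℕ) : ℤ))

/-- The integrals of `dhKer H ε` over `S` have a limit as `ε → 0⁺` which does not depend on the
smooth positive function `H`. -/
def DHGood (S : Set (EuclideanSpace ℝ (Fin (d + 1)))) : Prop :=
  MeasurableSet S ∧ Bornology.IsBounded S ∧ ∃ L : ℂ, ∀ H, ContDiff ℝ ∞ H → (∀ x, 0 < H x) →
    Tendsto (fun ε : ℝ => ∫ x in S, dhKer H ε x) (nhdsWithin 0 (Set.Ioi 0)) (nhds L)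

lemma continuous_dhKer {H : EuclideanSpace ℝ (Fin (d + 1)) → ℝ} (hH : Continuous H)
    (hpos : ∀ x, 0 < H x) {ε : ℝ} (hε : 0 < ε) : Continuous (dhKer H ε) := by
  refine Continuous.zpow₀ (by fun_prop) _ fun x => Or.inl fun h => ?_
  have := congrArg Complex.im h
  have h2 := mul_pos hε (hpos x)
  simp at this
  rcases this with h | h
  · exact hε.ne' h
  · exact (hpos x).ne' h

lemma isDiffClosed_dhGood :
    IsDiffClosed (DHGood : Set (EuclideanSpace ℝ (Fin (d + 1))) → Prop) where
  union {A B} hA hB hd := by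
    obtain ⟨hAm, hAb, L₁, h₁⟩ := hA
    obtain ⟨hBm, hBb, L₂, h₂⟩ := hB
    refine ⟨hAm.union hBm, hAb.union hBb, L₁ + L₂, fun H hH hp =>
      ((h₁ H hH hp).add (h₂ H hH hp)).congr' ?_⟩
    filter_upwards [self_mem_nhdsWithin] with ε hε
    have hc := continuous_dhKer hH.continuous hp hε
    rw [setIntegral_union hd hBm (hc.integrableOn_of_isBounded hAb)
      (hc.integrableOn_of_isBounded hBb)]
  diff {A B} hA hB hd := by
    obtain ⟨hAm, hAb, L₁, h₁⟩ := hA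
    obtain ⟨hBm, hBb, L₂, h₂⟩ := hB
    refine ⟨hAm.diff hBm, hAb.subset Set.sdiff_subset, L₁ - L₂, fun H hH hp =>
      ((h₁ H hH hp).sub (h₂ H hH hp)).congr' ?_⟩
    filter_upwards [self_mem_nhdsWithin] with ε hε
    have hc := continuous_dhKer hH.continuous hp hε
    rw [setIntegral_sdiff hBm (hc.integrableOn_of_isBounded hAb) hd]

lemma DHGood.congr_ae {S S' : Set (EuclideanSpace ℝ (Fin (d + 1)))} (hS : DHGood S)
    (hm : MeasurableSet S') (hb : Bornology.IsBounded S') (h : S =ᵐ[volume] S') : DHGood S' := by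
  obtain ⟨-, -, L, hL⟩ := hS
  refine ⟨hm, hb, L, fun H hH hp => ?_⟩
  simpa only [setIntegral_congr_set h] using hL H hH hp

lemma DHGood.preimage_add {S : Set (EuclideanSpace ℝ (Fin (d + 1)))} (hS : DHGood S)
    {c : EuclideanSpace ℝ (Fin (d + 1))} (hc : c 0 = 0) : DHGood ((fun x => x + c) ⁻¹' S) := by
  obtain ⟨hm, hb, L, hL⟩ := hS
  refine ⟨hm.preimage (measurable_add_const c), ?_, L, fun H hH hp => ?_⟩
  · refine (hb.vadd (-c)).subset fun x hx => ⟨x + c, hx, by simp [add_comm]⟩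
  · refine (hL (fun x => H (x - c)) (hH.comp (contDiff_id.sub contDiff_const))
      fun x => hp _).congr fun ε => ?_
    rw [← (measurePreserving_add_right volume c).setIntegral_preimage_emb
      (MeasurableEquiv.addRight c).measurableEmbedding]
    simp [dhKer, hc]

lemma tendsto_integral_dhKer_of_lt {B : Set (EuclideanSpace ℝ (Fin (d + 1)))}
    (hm : MeasurableSet B) (hb : Bornology.IsBounded B) {δ : ℝ} (hδ : 0 < δ)
    (hB : ∀ x ∈ B, δ ≤ |x 0|) {H : EuclideanSpace ℝ (Fin (d + 1)) → ℝ} (hH : Continuous H)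
    (hpos : ∀ x, 0 < H x) :
    Tendsto (fun ε : ℝ => ∫ x in B, dhKer H ε x) (nhdsWithin 0 (Set.Ioi 0))
      (nhds (∫ x in B, (x 0 : ℂ) ^ (-((d + 1 : ℕ) : ℤ)))) := by
  have hfin : IsFiniteMeasure (volume.restrict B) :=
    isFiniteMeasure_restrict.2 hb.measure_lt_top.ne
  refine tendsto_integral_filter_of_dominated_convergence (fun _ => (δ ^ (d + 1))⁻¹) ?_ ?_
    (integrable_const _) ?_
  · filter_upwards [self_mem_nhdsWithin] with ε hε
    exact (continuous_dhKer hH hpos hε).aestronglyMeasurable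
  · refine Eventually.of_forall fun ε => (ae_restrict_mem hm).mono fun x hx => ?_
    have hle : |x 0| ≤ ‖(x 0 : ℂ) - (ε * H x : ℝ) * Complex.I‖ := by
      have := Complex.abs_re_le_norm ((x 0 : ℂ) - (ε * H x : ℝ) * Complex.I)
      simpa using this
    simp only [dhKer, zpow_neg, zpow_natCast, norm_inv, norm_pow]
    gcongr
    exact (hB x hx).trans hle
  · refine (ae_restrict_mem hm).mono fun x hx => ?_
    have h0 : (x 0 : ℂ) ≠ 0 := by
      intro h
      have h1 := hB x hx
      rw [Complex.ofReal_eq_zero.1 h, abs_zero] at h1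
      exact hδ.not_ge h1
    have h1 : Tendsto (fun ε : ℝ => (x 0 : ℂ) - (ε * H x : ℝ) * Complex.I)
        (nhdsWithin 0 (Set.Ioi 0)) (nhds (x 0 : ℂ)) := by
      have : Continuous fun ε : ℝ => (x 0 : ℂ) - (ε * H x : ℝ) * Complex.I := by fun_prop
      simpa using (this.tendsto 0).mono_left nhdsWithin_le_nhds
    exact h1.zpow₀ _ (Or.inl h0)

lemma continuous_tailE : Continuous (tailE : EuclideanSpace ℝ (Fin (d + 1)) → _) := by
  refine (PiLp.continuous_toLp 2 _).comp (continuous_pi fun i => ?_)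
  simp only [Fin.tail]
  fun_prop

@[simp] lemma tailE_consE (h : ℝ) (z : EuclideanSpace ℝ (Fin d)) : tailE (consE h z) = z := by
  ext i
  simp

/-- Fubini for the integral over a slab of a truncated cylinder. -/
lemma setIntegral_slab {K : Set (EuclideanSpace ℝ (Fin d))} (hK : MeasurableSet K) (τ₀ : ℝ)
    {δ : ℝ} (hδ : 0 < δ) {f : EuclideanSpace ℝ (Fin (d + 1)) → ℂ} (hf : Continuous f) :
    ∫ x in {x | tailE x ∈ K ∧ ‖x‖ ^ 2 ≤ τ₀} ∩ {x | |x 0| ≤ δ}, f x =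
      ∫ t in -δ..δ, ∫ y in K ∩ {y | ‖y‖ ^ 2 ≤ τ₀ - t ^ 2}, f (consE t y) := by
  have hm : MeasurableSet ({x | tailE x ∈ K ∧ ‖x‖ ^ 2 ≤ τ₀} ∩
      {x : EuclideanSpace ℝ (Fin (d + 1)) | |x 0| ≤ δ}) :=
    ((hK.preimage continuous_tailE.measurable).inter (measurableSet_norm_sq_le τ₀)).inter
      (isClosed_le (by fun_prop) continuous_const).measurableSet
  have hb : Bornology.IsBounded ({x | tailE x ∈ K ∧ ‖x‖ ^ 2 ≤ τ₀} ∩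
      {x : EuclideanSpace ℝ (Fin (d + 1)) | |x 0| ≤ δ}) :=
    (isBounded_norm_sq_le τ₀).subset fun x hx => hx.1.2
  rw [← integral_indicator hm,
    integral_consE ((integrable_indicator_iff hm).2 (hf.integrableOn_of_isBounded hb)),
    intervalIntegral.integral_of_le (by linarith), ← integral_Icc_eq_integral_Ioc,
    ← integral_indicator measurableSet_Icc]
  refine integral_congr_ae (Eventually.of_forall fun t => ?_)
  simp only
  by_cases ht : t ∈ Set.Icc (-δ) δ
  · rw [Set.indicator_of_mem ht, ← integral_indicator
      (hK.inter (measurableSet_norm_sq_le (τ₀ - t ^ 2)))]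
    refine integral_congr_ae (Eventually.of_forall fun y => ?_)
    have e : consE t y ∈ {x | tailE x ∈ K ∧ ‖x‖ ^ 2 ≤ τ₀} ∩ {x | |x 0| ≤ δ} ↔
        y ∈ K ∩ {y | ‖y‖ ^ 2 ≤ τ₀ - t ^ 2} := by
      simp only [Set.mem_inter_iff, Set.mem_ofPred_eq, tailE_consE, norm_sq_consE,
        consE_zero, abs_le.2 ht, and_true, le_sub_iff_add_le']
    by_cases hy : y ∈ K ∩ {y | ‖y‖ ^ 2 ≤ τ₀ - t ^ 2}
    · exact (Set.indicator_of_mem (e.2 hy) f).trans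
        (Set.indicator_of_mem hy fun y => f (consE t y)).symm
    · exact (Set.indicator_of_notMem (mt e.1 hy) f).trans (Set.indicator_of_notMem hy _).symm
  · rw [Set.indicator_of_notMem ht]
    refine (integral_congr_ae (Eventually.of_forall fun y => ?_)).trans (integral_zero _ _)
    refine Set.indicator_of_notMem (fun h => ht (abs_le.1 ?_)) _
    simpa using h.2

lemma dhGood_cylinder {K : Set (EuclideanSpace ℝ (Fin d))} (hK : ParamSmooth K) (τ₀ : ℝ) :
    DHGood {x : EuclideanSpace ℝ (Fin (d + 1)) | tailE x ∈ K ∧ ‖x‖ ^ 2 ≤ τ₀} := by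
  set S := {x : EuclideanSpace ℝ (Fin (d + 1)) | tailE x ∈ K ∧ ‖x‖ ^ 2 ≤ τ₀} with hS
  have hm : MeasurableSet S :=
    (hK.1.preimage continuous_tailE.measurable).inter (measurableSet_norm_sq_le τ₀)
  have hb : Bornology.IsBounded S := (isBounded_norm_sq_le τ₀).subset fun x hx => hx.2
  obtain ⟨δ, hδ, h⟩ := exists_tendsto_slab hK τ₀ d
  have hT : MeasurableSet {x : EuclideanSpace ℝ (Fin (d + 1)) | |x 0| ≤ δ} :=
    (isClosed_le (by fun_prop) continuous_const).measurableSet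
  obtain ⟨L, hL, -⟩ := h (fun _ => 1) (fun _ => 1) contDiff_const (fun _ => one_pos)
    contDiff_const (fun _ => one_pos)
  refine ⟨hm, hb, L + ∫ x in S \ {x | |x 0| ≤ δ}, (x 0 : ℂ) ^ (-((d + 1 : ℕ) : ℤ)),
    fun H hH hp => ?_⟩
  obtain ⟨L', h1, h2⟩ := h (fun _ => 1) H contDiff_const (fun _ => one_pos) hH hp
  obtain rfl := tendsto_nhds_unique hL h1
  refine (h2.add (tendsto_integral_dhKer_of_lt (hm.diff hT) (hb.subset Set.sdiff_subset) hδ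
    (fun x hx => (not_le.1 hx.2).le) hH.continuous hp)).congr' ?_
  filter_upwards [self_mem_nhdsWithin] with ε hε
  have hc := continuous_dhKer hH.continuous hp hε
  rw [← integral_inter_add_sdiff hT (hc.integrableOn_of_isBounded hb),
    setIntegral_slab hK.1 τ₀ hδ hc]
  simp [dhKer]

lemma PolyGen.mem_iff_tailE {C : Set (EuclideanSpace ℝ (Fin (d + 1)))}
    (hC : PolyGen (horFun d) C) (x : EuclideanSpace ℝ (Fin (d + 1))) :
    x ∈ C ↔ consE 0 (tailE x) ∈ C := by
  have key : ∀ ℓ ∈ horFun d, ℓ x = ℓ (consE 0 (tailE x)) := by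
    rintro _ ⟨a, v, hv, rfl⟩
    have := inner_consE (x 0) (tailE x) v
    rw [consE_tailE] at this
    simp only [this, inner_consE, hv, zero_mul]
  induction hC with
  | univ => simp
  | inter s _ h₁ h₂ ih =>
    simp only [Set.mem_inter_iff, Set.mem_ofPred_eq, ← key _ h₁, ← key _ h₂, ih]

lemma measurable_of_mem_horFun {ℓ : EuclideanSpace ℝ (Fin (d + 1)) → ℝ} (h : ℓ ∈ horFun d) :
    Measurable ℓ := by
  obtain ⟨a, v, -, rfl⟩ := h
  exact Continuous.measurable (by fun_prop)

lemma norm_sq_le_affine_iff {G : Type*} [NormedAddCommGroup G] [InnerProductSpace ℝ G] (a : ℝ)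
    (v x : G) : ‖x‖ ^ 2 - (a + inner ℝ v x) =
      ‖x - (2⁻¹ : ℝ) • v‖ ^ 2 - (a + ‖(2⁻¹ : ℝ) • v‖ ^ 2) := by
  rw [norm_sub_sq_real, real_inner_smul_right, real_inner_comm]
  ring

lemma dhGood_ball_base (C : Set (EuclideanSpace ℝ (Fin (d + 1)))) (hC : PolyGen (horFun d) C)
    (ℓ : EuclideanSpace ℝ (Fin (d + 1)) → ℝ) (hℓ : ℓ ∈ horFun d) (s : Bool) :
    DHGood (C ∩ {x | CmpRel s (‖x‖ ^ 2) (ℓ x)}) := by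
  have hCm := hC.measurableSet fun _ => measurable_of_mem_horFun
  have hℓm := measurable_of_mem_horFun hℓ
  obtain ⟨a, v, hv, rfl⟩ := hℓ
  set c := (2⁻¹ : ℝ) • v with hc
  set τ₀ := a + ‖c‖ ^ 2 with hτ
  have hc0 : c 0 = 0 := by simp [hc, hv]
  have hC' : PolyGen (horFun d) ((fun x => x + c) ⁻¹' C) := by
    refine hC.preimage _ ?_
    rintro _ ⟨b, u, hu, rfl⟩
    refine ⟨b + inner ℝ u c, u, hu, ?_⟩
    funext x
    simp only [Function.comp, inner_add_right]
    ring
  have hK : PolyGen (affFun d) ((fun z => consE 0 z) ⁻¹' ((fun x => x + c) ⁻¹' C)) := by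
    refine hC'.preimage _ ?_
    rintro _ ⟨b, u, hu, rfl⟩
    refine ⟨b, tailE u, ?_⟩
    funext z
    simp [Function.comp, inner_consE]
  have key := (dhGood_cylinder (paramSmooth_of_polyGen_affFun _ _ hK) τ₀).preimage_add
    (c := -c) (by simp [hc0])
  have hw : ∀ x : EuclideanSpace ℝ (Fin (d + 1)), ‖x‖ ^ 2 ≤ a + inner ℝ v x ↔
      ‖x - c‖ ^ 2 ≤ τ₀ := fun x => by
    rw [← sub_nonpos, norm_sq_le_affine_iff, sub_nonpos]
  have e : (fun x => x + -c) ⁻¹' {x | tailE x ∈ (fun z => consE 0 z) ⁻¹'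
      ((fun x => x + c) ⁻¹' C) ∧ ‖x‖ ^ 2 ≤ τ₀} = C ∩ {x | ‖x‖ ^ 2 ≤ a + inner ℝ v x} := by
    ext x
    have := hC'.mem_iff_tailE (x - c)
    simp only [Set.mem_preimage, sub_add_cancel] at this
    simp only [Set.mem_preimage, Set.mem_ofPred_eq, Set.mem_inter_iff, hw, ← sub_eq_add_neg, this]
  rw [e] at key
  cases s
  · simpa only [cmpRel_false] using key
  · refine key.congr_ae (hCm.inter (measurableSet_cmpRel _ (by fun_prop) hℓm))
      (key.2.1.subset fun x hx => ⟨hx.1, CmpRel.le (s := true) hx.2⟩) ?_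
    have hnull : volume (sphere c √τ₀) = 0 := Measure.addHaar_sphere volume c _
    have hae : ∀ᵐ x, x ∉ sphere c √τ₀ := measure_eq_zero_iff_ae_notMem.1 hnull
    filter_upwards [hae] with x hx
    refine propext (and_congr_right fun _ => ?_)
    change ‖x‖ ^ 2 ≤ a + inner ℝ v x ↔ CmpRel true (‖x‖ ^ 2) (a + inner ℝ v x)
    rw [cmpRel_true]
    refine ⟨fun h => lt_of_le_of_ne h fun h' => hx ?_, le_of_lt⟩
    have h2 : ‖x - c‖ ^ 2 = τ₀ := by
      rw [← sub_eq_zero, ← norm_sq_le_affine_iff, h', sub_self]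
    rw [mem_sphere, dist_eq_norm, ← h2, Real.sqrt_sq (norm_nonneg _)]

end

section

variable {d : ℕ}

lemma const_mem_horFun (a : ℝ) : (fun _ => a) ∈ horFun d := ⟨a, 0, rfl, by simp⟩

lemma IsDHHalfSpace.exists_cmpRel {T : Set (EuclideanSpace ℝ (Fin (d + 1)))}
    (hT : IsDHHalfSpace T) : ∃ ℓ₁ ∈ insert (fun x => ‖x‖ ^ 2) (horFun d),
      ∃ ℓ₂ ∈ insert (fun x => ‖x‖ ^ 2) (horFun d), T = {x | CmpRel false (ℓ₁ x) (ℓ₂ x)} := by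
  have key : ∀ (c x : EuclideanSpace ℝ (Fin (d + 1))) (r : ℝ),
      ‖x‖ ^ 2 - (r ^ 2 - ‖c‖ ^ 2 + inner ℝ ((2 : ℝ) • c) x) = dist x c ^ 2 - r ^ 2 := by
    intro c x r
    rw [norm_sq_le_affine_iff, smul_smul, inv_mul_cancel₀ two_ne_zero, one_smul, dist_eq_norm]
    ring
  have hmem : ∀ (c : EuclideanSpace ℝ (Fin (d + 1))) (r : ℝ), c 0 = 0 →
      (fun x => r ^ 2 - ‖c‖ ^ 2 + inner ℝ ((2 : ℝ) • c) x) ∈ horFun d :=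
    fun c r hc => ⟨_, _, by simp [hc], rfl⟩
  rcases hT with ⟨c, r, hr, hc, rfl⟩ | ⟨c, r, hr, hc, rfl⟩ | ⟨v, t, -, hv, rfl⟩
  · refine ⟨_, Set.mem_insert _ _, _, Set.mem_insert_of_mem _ (hmem c r hc), ?_⟩
    ext x
    simp only [mem_closedBall, Set.mem_ofPred_eq, cmpRel_false]
    rw [← sub_nonpos (a := ‖x‖ ^ 2), key, sub_nonpos, sq_le_sq₀ dist_nonneg hr.le]
  · refine ⟨_, Set.mem_insert_of_mem _ (hmem c r hc), _, Set.mem_insert _ _, ?_⟩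
    ext x
    simp only [Set.mem_compl_iff, mem_ball, not_lt, Set.mem_ofPred_eq, cmpRel_false]
    rw [← sub_nonneg (a := ‖x‖ ^ 2), key, sub_nonneg, sq_le_sq₀ hr.le dist_nonneg]
  · refine ⟨_, Set.mem_insert_of_mem _ (const_mem_horFun t), _,
      Set.mem_insert_of_mem _ ⟨0, v, hv, rfl⟩, ?_⟩
    simp [cmpRel_false]

lemma IsDHPolytope.polyGen {P : Set (EuclideanSpace ℝ (Fin (d + 1)))} (hP : IsDHPolytope P) :
    PolyGen (insert (fun x => ‖x‖ ^ 2) (horFun d)) P := by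
  classical
  obtain ⟨S, hS, rfl⟩ := hP
  induction S using Finset.induction_on with
  | empty => simpa using PolyGen.univ
  | insert T S _ ih =>
    obtain ⟨ℓ₁, h₁, ℓ₂, h₂, rfl⟩ := (hS T (Finset.mem_insert_self _ _)).exists_cmpRel
    rw [Finset.coe_insert, Set.sInter_insert, Set.inter_comm]
    exact PolyGen.inter false (ih fun H hH => hS H (Finset.mem_insert_of_mem hH)) h₁ h₂

lemma IsDHPolytope.isClosed {P : Set (EuclideanSpace ℝ (Fin (d + 1)))} (hP : IsDHPolytope P) :
    IsClosed P := by
  obtain ⟨S, hS, rfl⟩ := hP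
  refine isClosed_sInter fun T hT => ?_
  rcases hS T hT with ⟨c, r, -, -, rfl⟩ | ⟨c, r, -, -, rfl⟩ | ⟨v, t, -, -, rfl⟩
  · exact isClosed_closedBall
  · exact isOpen_ball.isClosed_compl
  · exact isClosed_le continuous_const (by fun_prop)

lemma IsDHPolytope.dhGood {P : Set (EuclideanSpace ℝ (Fin (d + 1)))} (hP : IsDHPolytope P)
    (hb : Bornology.IsBounded P) : DHGood P := by
  obtain ⟨R, hR⟩ := isBounded_iff_forall_norm_le.1 hb
  convert isDiffClosed_dhGood.inter_le dhGood_ball_base hP.polyGen _ PolyGen.univ _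
    (const_mem_horFun (R ^ 2)) false using 1
  ext x
  simp only [Set.inter_univ, cmpRel_false, Set.mem_inter_iff, Set.mem_ofPred_eq, iff_self_and]
  intro hx
  have := hR x hx
  gcongr

/-- A smooth positive function which agrees with `‖x‖²` away from the origin. -/
lemma exists_smooth_pos_eq_norm_sq {G : Type*} [NormedAddCommGroup G] [InnerProductSpace ℝ G]
    [FiniteDimensional ℝ G] {m : ℝ} (hm : 0 < m) :
    ∃ H : G → ℝ, ContDiff ℝ ∞ H ∧ (∀ x, 0 < H x) ∧ ∀ x, m ≤ ‖x‖ → H x = ‖x‖ ^ 2 := by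
  let χ : ContDiffBump (0 : G) := ⟨m / 2, m, half_pos hm, half_lt_self hm⟩
  refine ⟨fun x => ‖x‖ ^ 2 + χ x, (contDiff_norm_sq ℝ).add χ.contDiff, fun x => ?_, fun x hx => ?_⟩
  · rcases eq_or_ne x 0 with rfl | hx
    · have : χ 0 = 1 := χ.one_of_mem_closedBall (mem_closedBall_self (half_pos hm).le)
      simp [this]
    · have h1 : 0 < ‖x‖ ^ 2 := pow_pos (norm_pos_iff.2 hx) 2
      have h2 : 0 ≤ χ x := χ.nonneg
      simp only
      linarith
  · have : χ x = 0 := χ.zero_of_le_dist (by simpa using hx)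
    simp [this]

lemma inversion_zero_one_eq {G : Type*} [NormedAddCommGroup G] [InnerProductSpace ℝ G] (x : G) :
    EuclideanGeometry.inversion (0 : G) 1 x = (‖x‖ ^ 2)⁻¹ • x := by
  simp [EuclideanGeometry.inversion]

/-- The change of variables formula for the inversion. -/
lemma setIntegral_inversion {P : Set (EuclideanSpace ℝ (Fin d))} (hP : MeasurableSet P)
    (h0 : 0 ∉ P) (f : EuclideanSpace ℝ (Fin d) → ℂ) :
    ∫ x in (fun x => (‖x‖ ^ 2)⁻¹ • x) '' P, f x =
      ∫ x in P, ((‖x‖ ^ 2)⁻¹ ^ d : ℝ) • f ((‖x‖ ^ 2)⁻¹ • x) := by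
  have hne : ∀ x ∈ P, x ≠ 0 := fun x hx h => h0 (h ▸ hx)
  have hinv : (fun x : EuclideanSpace ℝ (Fin d) => (‖x‖ ^ 2)⁻¹ • x) =
      EuclideanGeometry.inversion 0 1 := funext fun x => (inversion_zero_one_eq x).symm
  have hinj : Set.InjOn (EuclideanGeometry.inversion (0 : EuclideanSpace ℝ (Fin d)) 1) P :=
    (EuclideanGeometry.inversion_injective _ one_ne_zero).injOn
  rw [hinv, integral_image_eq_integral_abs_det_fderiv_smul volume hP
    (fun x hx => (EuclideanGeometry.hasFDerivAt_inversion (hne x hx)).hasFDerivWithinAt) hinj]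
  refine setIntegral_congr_fun hP fun x hx => ?_
  simp only [inversion_zero_one_eq]
  congr 1
  rw [ContinuousLinearMap.det, ContinuousLinearMap.toLinearMap_smul, LinearMap.det_smul,
    finrank_euclideanSpace_fin, abs_mul]
  have : |LinearMap.det (((Submodule.span ℝ {x - 0})ᗮ.reflection :
      EuclideanSpace ℝ (Fin d) →L[ℝ] EuclideanSpace ℝ (Fin d)) :
      EuclideanSpace ℝ (Fin d) →ₗ[ℝ] EuclideanSpace ℝ (Fin d))| = 1 := by
    have := Submodule.det_reflection ((Submodule.span ℝ {x - 0})ᗮ)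
    refine (congrArg abs this).trans ?_
    simp
  rw [this]
  simp

end

/-- **Proposition 7.1**: `μ_u(P)` is invariant under the inversion `g(x) = x/‖x‖²`:
for a bounded DH-polytope `P` with `0 ∉ P` and `n ≥ 2`, both limits
`lim_{ε→0⁺} μ_ε(P)` and `lim_{ε→0⁺} μ_ε(g(P))` exist and are equal. -/
theorem dh_volume_inversion_invariant (n : ℕ) [NeZero n] (hn : 2 ≤ n)
    (P : Set (EuclideanSpace ℝ (Fin n)))
    (hP : IsDHPolytope P) (hPb : Bornology.IsBounded P)
    (h0 : (0 : EuclideanSpace ℝ (Fin n)) ∉ P) :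
    ∃ L : ℂ,
      Tendsto (fun ε : ℝ => dhInt n P ε) (nhdsWithin 0 (Set.Ioi 0)) (nhds L) ∧
      Tendsto (fun ε : ℝ =>
          dhInt n ((fun x : EuclideanSpace ℝ (Fin n) => (‖x‖ ^ 2)⁻¹ • x) '' P) ε)
        (nhdsWithin 0 (Set.Ioi 0)) (nhds L) := by
  obtain ⟨d, rfl⟩ : ∃ d, n = d + 1 := ⟨n - 1, by lia⟩
  obtain ⟨hm, -, L, hL⟩ := IsDHPolytope.dhGood hP hPb
  obtain ⟨m, hmpos, hmP⟩ : ∃ m > 0, ∀ x ∈ P, m ≤ ‖x‖ := by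
    obtain ⟨m, hmpos, hball⟩ := Metric.isOpen_iff.1 (IsDHPolytope.isClosed hP).isOpen_compl 0 h0
    refine ⟨m, hmpos, fun x hx => not_lt.1 fun h => hball (by simpa using h) hx⟩
  obtain ⟨H, hH, hpos, hHeq⟩ := exists_smooth_pos_eq_norm_sq
    (G := EuclideanSpace ℝ (Fin (d + 1))) hmpos
  refine ⟨L, (hL (fun _ => 1) contDiff_const fun _ => one_pos).congr fun ε => ?_,
    (hL H hH hpos).congr fun ε => ?_⟩
  · simp [dhInt, dhKer]
  · rw [dhInt, setIntegral_inversion hm h0]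
    refine setIntegral_congr_fun hm fun x hx => ?_
    have hx0 : (‖x‖ : ℂ) ≠ 0 := by
      exact_mod_cast (hmpos.trans_le (hmP x hx)).ne'
    simp only [dhKer, hHeq x (hmP x hx), Complex.real_smul, PiLp.smul_apply, smul_eq_mul]
    have e : (((‖x‖ ^ 2)⁻¹ * x 0 : ℝ) : ℂ) - ε * Complex.I =
        ((‖x‖ : ℂ) ^ 2)⁻¹ * ((x 0 : ℂ) - (ε * ‖x‖ ^ 2 : ℝ) * Complex.I) := by
      push_cast
      field_simp
    rw [e, mul_zpow, ← mul_assoc]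
    push_cast
    rw [zpow_neg, zpow_neg, ← Nat.cast_succ, zpow_natCast, zpow_natCast, inv_pow, inv_inv,
      inv_mul_cancel₀ (pow_ne_zero _ (pow_ne_zero _ hx0)), one_mul]
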